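/- Let $d = q_1 \cdots q_r > 2$ be a square-free product of $r$ distinct primes all congruent to $7 \pmod 8$. Then the rank of the 2-class group of $L_d = \mathbb{Q}(\zeta_8, \sqrt{d})$ equals $2r - 1$. -/

import Mathlib

section PartM1
/-- elements of the form `X^2 - a Y^2`. -/
def IsNm {K : Type*} [Field K] (a z : K) : Prop := ∃ X Y : K, X ^ 2 - a * Y ^ 2 = z

theorem IsNm.mul {K : Type*} [Field K] {a z w : K} (hz : IsNm a z) (hw : IsNm a w) :
    IsNm a (z * w) := by
  obtain ⟨X, Y, rfl⟩ := hz
  obtain ⟨U, V, rfl⟩ := hw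
  exact ⟨X * U + a * Y * V, X * V + Y * U, by ring⟩

theorem IsNm.sq {K : Type*} [Field K] (a x : K) : IsNm a (x ^ 2) := ⟨x, 0, by ring⟩

theorem IsNm.inv {K : Type*} [Field K] {a z : K} (hz : IsNm a z) : IsNm a z⁻¹ := by
  by_cases h : z = 0
  · rw [h, inv_zero]; exact ⟨0, 0, by ring⟩
  have : z⁻¹ = z * (z⁻¹) ^ 2 := by field_simp
  rw [this]
  exact hz.mul (IsNm.sq a _)

theorem IsNm.div {K : Type*} [Field K] {a z w : K} (hz : IsNm a z) (hw : IsNm a w) :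
    IsNm a (z / w) := by
  rw [div_eq_mul_inv]; exact hz.mul hw.inv

theorem zsqrtd_reduce (k : ℕ) (hk : 0 < k) (s b : ℤ√(-(k : ℤ))) (hb : b ≠ 0) :
    ∃ t, 4 * (s - b * t).norm ≤ (1 + k) * b.norm := by
  have hD : (-(k : ℤ)) < 0 := by omega
  have hn : 0 < b.norm := by
    have h0 := Zsqrtd.norm_nonneg hD.le b
    have h1 : b.norm ≠ 0 := fun h => hb ((Zsqrtd.norm_eq_zero_iff hD b).1 h)
    omega
  set n := b.norm with hndef
  set u := (s * star b).re
  set v := (s * star b).im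
  -- rounding
  have key : ∀ x : ℤ, ∃ y : ℤ, (2 * (x - n * y)) ^ 2 ≤ n ^ 2 := by
    intro x
    refine ⟨(2 * x + n) / (2 * n), ?_⟩
    have h1 := Int.emod_add_mul_ediv (2 * x + n) (2 * n)
    have h2 := Int.emod_nonneg (2 * x + n) (show (2 * n) ≠ 0 by omega)
    have h3 := Int.emod_lt_of_pos (2 * x + n) (show 0 < 2 * n by omega)
    set y := (2 * x + n) / (2 * n)
    apply sq_le_sq'
    · linarith
    · linarith
  obtain ⟨y1, h1⟩ := key u
  obtain ⟨y2, h2⟩ := key v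
  refine ⟨⟨y1, y2⟩, ?_⟩
  have hbb : b * star b = ((n : ℤ) : ℤ√(-(k : ℤ))) := (Zsqrtd.norm_eq_mul_conj b).symm
  have e : (s - b * ⟨y1, y2⟩) * star b = ⟨u - n * y1, v - n * y2⟩ := by
    have : (s - b * ⟨y1, y2⟩) * star b = s * star b - (b * star b) * ⟨y1, y2⟩ := by ring
    rw [this, hbb]
    ext
    · simp [u]
    · simp [v]
  have e2 : (s - b * ⟨y1, y2⟩).norm * n = (u - n * y1) ^ 2 + k * (v - n * y2) ^ 2 := by
    have := congrArg Zsqrtd.norm e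
    rw [Zsqrtd.norm_mul, Zsqrtd.norm_conj] at this
    rw [this, Zsqrtd.norm_def]; ring
  have hk' : (0 : ℤ) ≤ k := by omega
  have e3 : 4 * (s - b * ⟨y1, y2⟩).norm * n ≤ ((1 + k) * n) * n := by
    nlinarith [mul_le_mul_of_nonneg_left h2 hk']
  exact le_of_mul_le_mul_right e3 hn

theorem descent_one {K : Type*} [Field K] (φ : ℤ√(-(1 : ℕ)) →+* K)
    (hinj : Function.Injective φ)
    (hsq : ∃ y, y ^ 2 = φ ⟨0, 1⟩) (n : ℕ) :
    ∀ b : ℤ√(-(1 : ℕ)), b.norm.natAbs ≤ n → b ≠ 0 → (∃ s m, s ^ 2 - ⟨1, 1⟩ = b * m) →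
      IsNm (φ ⟨1, 1⟩) (φ b) := by
  have hD : (-((1 : ℕ) : ℤ)) < 0 := by norm_num
  obtain ⟨z, hz⟩ := hsq
  have hm1 : IsNm (φ ⟨1, 1⟩) (φ (-1)) := by
    have : φ (-1) = (φ ⟨0, 1⟩) ^ 2 := by
      rw [← map_pow]; congr 1
    rw [this]; exact IsNm.sq _ _
  have hi : IsNm (φ ⟨1, 1⟩) (φ ⟨0, 1⟩) := by
    rw [← hz]; exact IsNm.sq _ _
  have h1 : IsNm (φ ⟨1, 1⟩) (φ 1) := by
    have : φ 1 = 1 ^ 2 := by simp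
    rw [this]; exact IsNm.sq _ _
  have ha : IsNm (φ ⟨1, 1⟩) (φ (-⟨1, 1⟩)) := ⟨0, 1, by rw [map_neg]; ring⟩
  have hmul : ∀ x y, IsNm (φ ⟨1, 1⟩) (φ x) → IsNm (φ ⟨1, 1⟩) (φ y) →
      IsNm (φ ⟨1, 1⟩) (φ (x * y)) := fun x y hx hy => by rw [map_mul]; exact hx.mul hy
  induction n with
  | zero =>
    intro b hb hb0
    have : b.norm = 0 := by omega
    exact absurd ((Zsqrtd.norm_eq_zero_iff hD b).1 this) hb0
  | succ n ih =>
    intro b hb hb0 ⟨s, m, hsm⟩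
    have hnn := Zsqrtd.norm_nonneg hD.le b
    have hnz : b.norm ≠ 0 := fun h => hb0 ((Zsqrtd.norm_eq_zero_iff hD b).1 h)
    by_cases hsmall : b.norm ≤ 2
    · obtain ⟨x, y⟩ := b
      rw [Zsqrtd.norm_def] at hsmall hnz
      simp only at hsmall hnz
      have hx : x ^ 2 ≤ 2 := by push_cast at hsmall; nlinarith [sq_nonneg y]
      have hy : y ^ 2 ≤ 2 := by push_cast at hsmall; nlinarith [sq_nonneg x]
      have hx1 : -1 ≤ x := by nlinarith
      have hx2 : x ≤ 1 := by nlinarith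
      have hy1 : -1 ≤ y := by nlinarith
      have hy2 : y ≤ 1 := by nlinarith
      have hcases : (⟨x, y⟩ : ℤ√(-(1 : ℕ))) ∈ ({1, -1, ⟨0, 1⟩, -1 * ⟨0, 1⟩, -⟨1, 1⟩, -1 * -⟨1, 1⟩,
          ⟨0, 1⟩ * -⟨1, 1⟩, -1 * (⟨0, 1⟩ * -⟨1, 1⟩)} : Finset (ℤ√(-(1 : ℕ)))) := by
        interval_cases x <;> interval_cases y <;> first | decide | (exfalso; apply hnz; decide)
      simp only [Finset.mem_insert, Finset.mem_singleton] at hcases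
      rcases hcases with h | h | h | h | h | h | h | h <;> rw [h]
      · exact h1
      · exact hm1
      · exact hi
      · exact hmul _ _ hm1 hi
      · exact ha
      · exact hmul _ _ hm1 ha
      · exact hmul _ _ hi ha
      · exact hmul _ _ hm1 (hmul _ _ hi ha)
    · obtain ⟨t, ht⟩ := zsqrtd_reduce 1 one_pos s b hb0
      set s' := s - b * t with hs'
      have hsm' : s' ^ 2 - ⟨1, 1⟩ = b * (m - 2 * s * t + b * t ^ 2) := by
        rw [mul_add, mul_sub, ← hsm, hs']; ring
      set m' := m - 2 * s * t + b * t ^ 2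
      have hm0 : m' ≠ 0 := by
        intro h
        rw [h, mul_zero, sub_eq_zero] at hsm'
        have := congrArg Zsqrtd.norm hsm'
        rw [sq, Zsqrtd.norm_mul] at this
        have h2 : (⟨1, 1⟩ : ℤ√(-(1 : ℕ))).norm = 2 := by decide
        rw [h2] at this
        have hh : s'.norm ≤ 1 := by nlinarith
        have hh' : -1 ≤ s'.norm := by nlinarith
        interval_cases s'.norm <;> omega
      have hN : (s' ^ 2 - (⟨1, 1⟩ : ℤ√(-(1 : ℕ)))).norm ≤ 2 * s'.norm ^ 2 + 4 := by
        have e : s'.norm ^ 2 = (s' ^ 2).norm := by rw [sq, sq, Zsqrtd.norm_mul]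
        rw [e]
        generalize s' ^ 2 = w
        obtain ⟨p, r⟩ := w
        rw [Zsqrtd.norm_def, Zsqrtd.norm_def]
        simp
        nlinarith [sq_nonneg (p + 1), sq_nonneg (r + 1)]
      have hs0 := Zsqrtd.norm_nonneg hD.le s'
      have hm'0 := Zsqrtd.norm_nonneg hD.le m'
      have hlt : m'.norm < b.norm := by
        rw [hsm', Zsqrtd.norm_mul] at hN
        push_cast at ht
        by_contra hcon
        have h5 : b.norm * b.norm ≤ b.norm * m'.norm := mul_le_mul_of_nonneg_left (by omega) hnn
        have h6 : (2 * s'.norm) ^ 2 ≤ b.norm ^ 2 := by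
          apply pow_le_pow_left₀ (by omega) (by omega)
        have h7 : 3 ≤ b.norm := by omega
        nlinarith
      have := ih m' (by omega) hm0 ⟨s', b, by rw [hsm', mul_comm]⟩
      have hq : φ b = (φ s' ^ 2 - φ ⟨1, 1⟩ * 1 ^ 2) / φ m' := by
        have hne : φ m' ≠ 0 := by rwa [Ne, map_eq_zero_iff φ hinj]
        rw [eq_div_iff hne, ← map_mul, ← hsm']; simp
      rw [hq]
      exact IsNm.div ⟨_, _, rfl⟩ this

theorem descent_two {K : Type*} [Field K] (φ : ℤ√(-(2 : ℕ)) →+* K)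
    (hinj : Function.Injective φ)
    (hsq : ∃ y : K, y ^ 2 = -1) (hsq2 : ∃ y : K, y ^ 2 = 2) (n : ℕ) :
    ∀ b : ℤ√(-(2 : ℕ)), b.norm.natAbs ≤ n → b ≠ 0 → (∃ s m, s ^ 2 - ⟨0, 1⟩ = b * m) →
      IsNm (φ ⟨0, 1⟩) (φ b) := by
  have hD : (-((2 : ℕ) : ℤ)) < 0 := by norm_num
  obtain ⟨z, hz⟩ := hsq
  obtain ⟨w, hw⟩ := hsq2
  have hm1 : IsNm (φ ⟨0, 1⟩) (φ (-1)) := by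
    have : φ (-1) = z ^ 2 := by rw [hz]; simp
    rw [this]; exact IsNm.sq _ _
  have h2 : IsNm (φ ⟨0, 1⟩) (φ 2) := by
    have : φ 2 = w ^ 2 := by rw [hw]; exact map_ofNat φ 2
    rw [this]; exact IsNm.sq _ _
  have h1 : IsNm (φ ⟨0, 1⟩) (φ 1) := by
    have : φ 1 = 1 ^ 2 := by simp
    rw [this]; exact IsNm.sq _ _
  have ha : IsNm (φ ⟨0, 1⟩) (φ (-⟨0, 1⟩)) := ⟨0, 1, by rw [map_neg]; ring⟩
  have hc : IsNm (φ ⟨0, 1⟩) (φ (1 - ⟨0, 1⟩)) := ⟨1, 1, by rw [map_sub, map_one]; ring⟩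
  have hmul : ∀ x y, IsNm (φ ⟨0, 1⟩) (φ x) → IsNm (φ ⟨0, 1⟩) (φ y) →
      IsNm (φ ⟨0, 1⟩) (φ (x * y)) := fun x y hx hy => by rw [map_mul]; exact hx.mul hy
  induction n with
  | zero =>
    intro b hb hb0
    have : b.norm = 0 := by omega
    exact absurd ((Zsqrtd.norm_eq_zero_iff hD b).1 this) hb0
  | succ n ih =>
    intro b hb hb0 ⟨s, m, hsm⟩
    have hnn := Zsqrtd.norm_nonneg hD.le b
    have hnz : b.norm ≠ 0 := fun h => hb0 ((Zsqrtd.norm_eq_zero_iff hD b).1 h)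
    by_cases hsmall : b.norm ≤ 5
    · have hbad : ∀ m', s ^ 2 - ⟨0, 1⟩ ≠ (⟨1, 1⟩ : ℤ√(-(2 : ℕ))) * m' := by
        intro m' h
        obtain ⟨p, r⟩ := s
        obtain ⟨u, v⟩ := m'
        have e1 := congrArg Zsqrtd.re h
        have e2 := congrArg Zsqrtd.im h
        rw [sq] at e1 e2
        simp only [Zsqrtd.re_sub, Zsqrtd.im_sub, Zsqrtd.re_mul, Zsqrtd.im_mul] at e1 e2
        push_cast at e1 e2
        have h3 : (p - r) ^ 2 + 1 = 3 * (r ^ 2 * (-1) - v) + 6 * r ^ 2 * 1  - 0 ∨ True := Or.inr trivial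
        have h4 : ((p - r) ^ 2 + 1) % 3 = 0 := by
          apply Int.emod_eq_zero_of_dvd
          exact ⟨r ^ 2 - v, by linarith⟩
        have h5 : (p - r) % 3 = 0 ∨ (p - r) % 3 = 1 ∨ (p - r) % 3 = 2 := by omega
        rcases h5 with h5 | h5 | h5 <;> simp [sq, Int.add_emod, Int.mul_emod, h5] at h4
      obtain ⟨x, y⟩ := b
      rw [Zsqrtd.norm_def] at hsmall hnz
      simp only at hsmall hnz
      have hx : x ^ 2 ≤ 5 := by push_cast at hsmall; nlinarith [sq_nonneg y]
      have hy : y ^ 2 ≤ 2 := by push_cast at hsmall; nlinarith [sq_nonneg x]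
      have hx1 : -2 ≤ x := by nlinarith
      have hx2 : x ≤ 2 := by nlinarith
      have hy1 : -1 ≤ y := by nlinarith
      have hy2 : y ≤ 1 := by nlinarith
      have hcases : (⟨x, y⟩ : ℤ√(-(2 : ℕ))) ∈ ({1, -1, -⟨0, 1⟩, -1 * -⟨0, 1⟩, 2, -1 * 2,
          1 - ⟨0, 1⟩, -1 * (1 - ⟨0, 1⟩), ⟨1, 1⟩, -⟨1, 1⟩} : Finset (ℤ√(-(2 : ℕ)))) := by
        interval_cases x <;> interval_cases y <;>
          first | decide | (exfalso; apply hnz; decide) | (exfalso; revert hsmall; decide)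
      simp only [Finset.mem_insert, Finset.mem_singleton] at hcases
      rcases hcases with h | h | h | h | h | h | h | h | h | h
      · rw [h]; exact h1
      · rw [h]; exact hm1
      · rw [h]; exact ha
      · rw [h]; exact hmul _ _ hm1 ha
      · rw [h]; exact h2
      · rw [h]; exact hmul _ _ hm1 h2
      · rw [h]; exact hc
      · rw [h]; exact hmul _ _ hm1 hc
      · rw [h] at hsm; exact absurd hsm (hbad m)
      · rw [h] at hsm; exact absurd (hsm.trans (neg_mul_comm _ _)) (hbad (-m))
    · obtain ⟨t, ht⟩ := zsqrtd_reduce 2 two_pos s b hb0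
      set s' := s - b * t with hs'
      have hsm' : s' ^ 2 - ⟨0, 1⟩ = b * (m - 2 * s * t + b * t ^ 2) := by
        rw [mul_add, mul_sub, ← hsm, hs']; ring
      set m' := m - 2 * s * t + b * t ^ 2
      have hm0 : m' ≠ 0 := by
        intro h
        rw [h, mul_zero, sub_eq_zero] at hsm'
        have := congrArg Zsqrtd.norm hsm'
        rw [sq, Zsqrtd.norm_mul] at this
        have h2 : (⟨0, 1⟩ : ℤ√(-(2 : ℕ))).norm = 2 := by decide
        rw [h2] at this
        have hh : s'.norm ≤ 1 := by nlinarith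
        have hh' : -1 ≤ s'.norm := by nlinarith
        interval_cases s'.norm <;> omega
      have hN : 36 * (s' ^ 2 - (⟨0, 1⟩ : ℤ√(-(2 : ℕ)))).norm ≤ 52 * s'.norm ^ 2 + 234 := by
        have e : s'.norm ^ 2 = (s' ^ 2).norm := by rw [sq, sq, Zsqrtd.norm_mul]
        rw [e]
        generalize s' ^ 2 = w
        obtain ⟨p, r⟩ := w
        rw [Zsqrtd.norm_def, Zsqrtd.norm_def]
        simp
        nlinarith [sq_nonneg (4 * r + 9), sq_nonneg p]
      have hs0 := Zsqrtd.norm_nonneg hD.le s'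
      have hm'0 := Zsqrtd.norm_nonneg hD.le m'
      have hlt : m'.norm < b.norm := by
        rw [hsm', Zsqrtd.norm_mul] at hN
        push_cast at ht
        by_contra hcon
        have h5 : b.norm * b.norm ≤ b.norm * m'.norm := mul_le_mul_of_nonneg_left (by omega) hnn
        have h6 : (4 * s'.norm) ^ 2 ≤ (3 * b.norm) ^ 2 := by
          apply pow_le_pow_left₀ (by omega) (by omega)
        have h7 : 6 ≤ b.norm := by omega
        nlinarith
      have := ih m' (by omega) hm0 ⟨s', b, by rw [hsm', mul_comm]⟩
      have hq : φ b = (φ s' ^ 2 - φ ⟨0, 1⟩ * 1 ^ 2) / φ m' := by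
        have hne : φ m' ≠ 0 := by rwa [Ne, map_eq_zero_iff φ hinj]
        rw [eq_div_iff hne, ← map_mul, ← hsm']; simp
      rw [hq]
      exact IsNm.div ⟨_, _, rfl⟩ this

/-- auxiliary facts on primes `7 mod 8`. -/
theorem q7_aux (q : ℕ) (hq : q.Prime) (h7 : q % 8 = 7) :
    ∃ c : ZMod q, c ^ 2 = 2 ∧ c ≠ 0 ∧ c + 1 ≠ 0 ∧
      ∀ x : ZMod q, ∃ e : ZMod q, e ^ 2 = x ∨ e ^ 2 = -x := by
  have : Fact q.Prime := ⟨hq⟩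
  have hq2 : q ≠ 2 := by rintro rfl; omega
  obtain ⟨c, hc⟩ := (ZMod.exists_sq_eq_two_iff hq2).2 (Or.inr h7)
  have hc2 : c ^ 2 = 2 := by rw [hc]; ring
  have h20 : (2 : ZMod q) ≠ 0 := by
    intro h
    have : ((2 : ℕ) : ZMod q) = 0 := by exact_mod_cast h
    rw [ZMod.natCast_eq_zero_iff] at this
    exact hq2 ((Nat.prime_dvd_prime_iff_eq hq Nat.prime_two).1 this)
  refine ⟨c, hc2, ?_, ?_, ?_⟩
  · rintro rfl; apply h20; rw [← hc2]; ring
  · intro h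
    have : c = -1 := by linear_combination h
    rw [this] at hc2
    have : (1 : ZMod q) = 0 := by linear_combination -hc2
    exact one_ne_zero this
  · intro x
    by_cases hx : IsSquare x
    · obtain ⟨e, he⟩ := hx; exact ⟨e, Or.inl (by rw [he]; ring)⟩
    have hx0 : x ≠ 0 := by rintro rfl; exact hx ⟨0, by ring⟩
    have hm : ¬ IsSquare (-1 : ZMod q) := by
      rw [ZMod.exists_sq_eq_neg_one_iff]; omega
    have h1 := (quadraticChar_neg_one_iff_not_isSquare).2 hx
    have h2 := (quadraticChar_neg_one_iff_not_isSquare).2 hm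
    have h3 : quadraticChar (ZMod q) (-x) = 1 := by
      rw [neg_eq_neg_one_mul, map_mul, h1, h2]; norm_num
    rw [quadraticChar_one_iff_isSquare (neg_ne_zero.2 hx0)] at h3
    obtain ⟨e, he⟩ := h3
    exact ⟨e, Or.inr (by rw [he]; ring)⟩

theorem q7_int_aux (q : ℕ) (hq : q.Prime) (h7 : q % 8 = 7) (u v : ℤ)
    (huv : ∀ c : ZMod q, c ^ 2 = 2 → c ≠ 0 → c + 1 ≠ 0 → (u + v * c : ZMod q) ≠ 0) :
    ∃ c e : ℤ, (q : ℤ) ∣ c ^ 2 - 2 ∧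
      ((q : ℤ) ∣ e ^ 2 * (u + v * c) - 1 ∨ (q : ℤ) ∣ e ^ 2 * (u + v * c) + 1) := by
  have : Fact q.Prime := ⟨hq⟩
  obtain ⟨c, hc, hc0, hc1, h⟩ := q7_aux q hq h7
  have hne := huv c hc hc0 hc1
  obtain ⟨e, he⟩ := h ((u + v * c : ZMod q)⁻¹)
  obtain ⟨c, rfl⟩ := ZMod.intCast_surjective c
  obtain ⟨e, rfl⟩ := ZMod.intCast_surjective e
  refine ⟨c, e, ?_, ?_⟩
  · rw [← ZMod.intCast_zmod_eq_zero_iff_dvd]; push_cast; rw [hc]; ring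
  · rcases he with he | he
    · left
      rw [← ZMod.intCast_zmod_eq_zero_iff_dvd]; push_cast; rw [he]; field_simp; ring
    · right
      rw [← ZMod.intCast_zmod_eq_zero_iff_dvd]; push_cast; rw [he]; field_simp; ring

theorem q7_two_ne (q : ℕ) (hq : q.Prime) (h7 : q % 8 = 7) : (2 : ZMod q) ≠ 0 := by
  intro h
  have : ((2 : ℕ) : ZMod q) = 0 := by exact_mod_cast h
  rw [ZMod.natCast_eq_zero_iff] at this
  have := (Nat.prime_dvd_prime_iff_eq hq Nat.prime_two).1 this
  omega

theorem q7_one (q : ℕ) (hq : q.Prime) (h7 : q % 8 = 7) :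
    ∃ s m : ℤ√(-(1 : ℕ)), s ^ 2 - ⟨1, 1⟩ = (q : ℤ√(-(1 : ℕ))) * m := by
  have : Fact q.Prime := ⟨hq⟩
  obtain ⟨c, e, ⟨x, hx⟩, h⟩ := q7_int_aux q hq h7 2 2 (by
    intro c _ _ h h'
    push_cast at h'
    have : 2 * (c + 1) = 0 := by linear_combination h'
    rcases mul_eq_zero.1 this with h1 | h1
    · exact q7_two_ne q hq h7 h1
    · exact h h1)
  have hx' := congrArg (Int.cast : ℤ → ℤ√(-(1 : ℕ))) hx
  push_cast at hx'
  have hi : (⟨0, 1⟩ : ℤ√(-(1 : ℕ))) ^ 2 = -1 := by decide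
  have ha : (⟨1, 1⟩ : ℤ√(-(1 : ℕ))) = 1 + ⟨0, 1⟩ := by decide
  rw [ha]
  generalize (⟨0, 1⟩ : ℤ√(-(1 : ℕ))) = i at *
  rcases h with ⟨y, hy⟩ | ⟨y, hy⟩ <;>
  · have hy' := congrArg (Int.cast : ℤ → ℤ√(-(1 : ℕ))) hy
    push_cast at hy'
    first
    | exact ⟨e * (1 + i + c), (1 + i) * y + e ^ 2 * x, by
        linear_combination (1 + i) * hy' + e ^ 2 * hx' + e ^ 2 * hi⟩
    | exact ⟨i * e * (1 + i + c), -(1 + i) * y - e ^ 2 * x, by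
        linear_combination -(1 + i) * hy' - e ^ 2 * hx' +
          (e ^ 2 * (1 + i + c) ^ 2 - e ^ 2) * hi⟩

theorem q7_two (q : ℕ) (hq : q.Prime) (h7 : q % 8 = 7) :
    ∃ s m : ℤ√(-(2 : ℕ)), s ^ 2 - ⟨0, 1⟩ = (q : ℤ√(-(2 : ℕ))) * m := by
  have : Fact q.Prime := ⟨hq⟩
  obtain ⟨c, e, ⟨x, hx⟩, h⟩ := q7_int_aux q hq h7 0 2 (by
    intro c _ h _ h'
    push_cast at h'
    have : 2 * c = 0 := by linear_combination h'
    rcases mul_eq_zero.1 this with h1 | h1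
    · exact q7_two_ne q hq h7 h1
    · exact h h1)
  have hx' := congrArg (Int.cast : ℤ → ℤ√(-(2 : ℕ))) hx
  push_cast at hx'
  have hi : (⟨0, 1⟩ : ℤ√(-(2 : ℕ))) ^ 2 = -2 := by decide
  generalize (⟨0, 1⟩ : ℤ√(-(2 : ℕ))) = i at *
  rcases h with ⟨y, hy⟩ | ⟨y, hy⟩ <;>
  · have hy' := congrArg (Int.cast : ℤ → ℤ√(-(2 : ℕ))) hy
    push_cast at hy'
    first
    | exact ⟨e * (i + c), i * y + e ^ 2 * x, by
        linear_combination i * hy' + e ^ 2 * hx' + e ^ 2 * hi⟩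
    | exact ⟨e * (i - c), - i * y + e ^ 2 * x, by
        linear_combination -i * hy' + e ^ 2 * hx' + e ^ 2 * hi⟩

theorem zsqrtd_lift_inj {K : Type*} [Field K] [CharZero K] (k : ℕ) (hk : 0 < k)
    (φ : ℤ√(-(k : ℤ)) →+* K) : Function.Injective φ := by
  rw [injective_iff_map_eq_zero]
  intro a ha
  have h1 : φ ((a.norm : ℤ) : ℤ√(-(k : ℤ))) = 0 := by
    rw [Zsqrtd.norm_eq_mul_conj, map_mul, ha, zero_mul]
  rw [map_intCast, Int.cast_eq_zero] at h1
  exact (Zsqrtd.norm_eq_zero_iff (by omega) a).1 h1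

theorem isNm_prod {K : Type*} [Field K] (a : K) (d : ℕ) (hd : Squarefree d)
    (h : ∀ p ∈ d.primeFactors, IsNm a (p : K)) : IsNm a (d : K) := by
  rw [← Nat.prod_primeFactors_of_squarefree hd, Nat.cast_prod]
  revert h
  generalize d.primeFactors = s
  intro h
  induction s using Finset.cons_induction with
  | empty => simpa using IsNm.sq a 1
  | cons p s hp ih =>
    rw [Finset.prod_cons]
    exact (h p (by simp)).mul (ih fun q hq => h q (by simp [hq]))

theorem IsNm.flip {K : Type*} [Field K] (a d : K) (hd : ¬ IsSquare d) (h : IsNm a d) :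
    IsNm d a := by
  obtain ⟨X, Y, h⟩ := h
  have hY : Y ≠ 0 := by
    rintro rfl
    exact hd ⟨X, by rw [← h]; ring⟩
  refine ⟨X / Y, 1 / Y, ?_⟩
  field_simp
  linear_combination h

/-- the key arithmetic input: `ζ` and `1 + √2` are norms from `K(√d)`. -/
theorem isNm_zeta {K : Type*} [Field K] [CharZero K] (ζ : K) (hζ : ζ ^ 4 = -1)
    (d : ℕ) (hd : Squarefree d) (hp : ∀ p ∈ d.primeFactors, p % 8 = 7)
    (hns : ¬ IsSquare (d : K)) :
    IsNm (d : K) ζ ∧ IsNm (d : K) (1 + (ζ - ζ ^ 3)) := by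
  have h2 : (2 : K) ≠ 0 := two_ne_zero
  have hz0 : ζ ≠ 0 := by rintro rfl; norm_num at hζ
  let φ1 : ℤ√(-((1 : ℕ) : ℤ)) →+* K := Zsqrtd.lift ⟨ζ ^ 2, by push_cast; linear_combination hζ⟩
  let φ2 : ℤ√(-((2 : ℕ) : ℤ)) →+* K := Zsqrtd.lift ⟨ζ + ζ ^ 3, by
    push_cast; linear_combination (2 + ζ ^ 2) * hζ⟩
  have e1 : φ1 ⟨1, 1⟩ = 1 + ζ ^ 2 := by simp [φ1, Zsqrtd.lift]
  have e1' : φ1 ⟨0, 1⟩ = ζ ^ 2 := by simp [φ1, Zsqrtd.lift]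
  have e2 : φ2 ⟨0, 1⟩ = ζ + ζ ^ 3 := by simp [φ2, Zsqrtd.lift]
  have A : IsNm (d : K) (1 + ζ ^ 2) := by
    apply IsNm.flip _ _ hns
    apply isNm_prod _ _ hd
    intro p hpd
    have hpp := Nat.prime_of_mem_primeFactors hpd
    have := descent_one φ1 (zsqrtd_lift_inj 1 one_pos φ1) ⟨ζ, e1'.symm⟩ _ (p : ℤ√(-((1 : ℕ) : ℤ)))
      le_rfl (by exact_mod_cast hpp.ne_zero) (q7_one p hpp (hp p hpd))
    rwa [e1, map_natCast] at this
  have B : IsNm (d : K) (ζ + ζ ^ 3) := by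
    apply IsNm.flip _ _ hns
    apply isNm_prod _ _ hd
    intro p hpd
    have hpp := Nat.prime_of_mem_primeFactors hpd
    have := descent_two φ2 (zsqrtd_lift_inj 2 two_pos φ2) ⟨ζ ^ 2, by linear_combination hζ⟩
      ⟨ζ - ζ ^ 3, by linear_combination (-2 + ζ ^ 2) * hζ⟩ _ (p : ℤ√(-((2 : ℕ) : ℤ)))
      le_rfl (by exact_mod_cast hpp.ne_zero) (q7_two p hpp (hp p hpd))
    rwa [e2, map_natCast] at this
  have hne : (1 + ζ ^ 2) ≠ 0 := by
    intro h
    have : ζ ^ 4 = 1 := by linear_combination (ζ ^ 2 - 1) * h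
    rw [hζ] at this
    apply h2; linear_combination -this
  constructor
  · have := B.div A
    have e : (ζ + ζ ^ 3) / (1 + ζ ^ 2) = ζ := by field_simp
    rwa [e] at this
  · have e : 1 + (ζ - ζ ^ 3) = (1 + (ζ - ζ ^ 3) + ζ ^ 2) ^ 2 / ((ζ - ζ ^ 3) ^ 2 * (1 + ζ ^ 2)) := by
      have hw : (ζ - ζ ^ 3) ^ 2 = 2 := by linear_combination (-2 + ζ ^ 2) * hζ
      rw [hw]
      field_simp
      linear_combination (1 - ζ ^ 2) * hζ
    rw [e]
    exact (IsNm.sq _ _).div ((IsNm.sq _ _).mul A)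

theorem relIndex_map_aux {G G' : Type*} [CommGroup G] [CommGroup G'] (f : G →* G')
    (T S : Subgroup G) (h : ∀ x ∈ S, f x = 1 → x ∈ T) (hTS : T ≤ S) :
    (T.map f).relIndex (S.map f) = T.relIndex S := by
  rw [Subgroup.relIndex_map_map]
  have e : S ⊔ f.ker = S ⊔ (T ⊔ f.ker) := by
    rw [← sup_assoc, sup_eq_left.mpr hTS]
  rw [e, Subgroup.relIndex_sup_right, ← Subgroup.inf_relIndex_right]
  congr 1
  apply le_antisymm
  · rintro x ⟨hx1, hx2⟩
    obtain ⟨a, ha, b, hb, rfl⟩ := Subgroup.mem_sup.mp hx1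
    have hbS : b ∈ S := by
      have := S.mul_mem (S.inv_mem (hTS ha)) hx2
      simpa using this
    exact T.mul_mem ha (h b hbS hb)
  · exact le_inf le_sup_left hTS

/-- Herbrand quotient computation, index form. -/
theorem herbrand_aux {M : Type*} [CommGroup M] (σ : M →* M) (hσ : ∀ x, σ (σ x) = x)
    (A : Subgroup M) (hA : ∀ x ∈ A, σ x ∈ A)
    (C B NA D : Subgroup M)
    (hC : ∀ x, x ∈ C ↔ x ∈ A ∧ σ x = x)
    (hB : ∀ x, x ∈ B ↔ x ∈ A ∧ x * σ x = 1)
    (hN : ∀ x, x ∈ NA ↔ ∃ y ∈ A, y * σ y = x)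
    (hD : ∀ x, x ∈ D ↔ ∃ y ∈ A, y / σ y = x)
    (c b : ℕ)
    (hc : (C.map (powMonoidHom 2)).relIndex C = 2 ^ c)
    (hb : (B.map (powMonoidHom 2)).relIndex B = 2 ^ b) :
    ∃ e f : ℕ, NA.relIndex C = 2 ^ e ∧ D.relIndex B = 2 ^ f ∧ e + b = f + c := by
  let n : M →* M := (MonoidHom.id M) * σ
  let δ : M →* M := (MonoidHom.id M) / σ
  have hn : ∀ x, n x = x * σ x := fun x => rfl
  have hδ : ∀ x, δ x = x / σ x := fun x => rfl
  have hCA : C ≤ A := fun x hx => ((hC x).1 hx).1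
  have hBA : B ≤ A := fun x hx => ((hB x).1 hx).1
  have e1 : A.map n = NA := by ext x; simp [hN, hn]
  have e2 : A.map δ = D := by ext x; simp [hD, hδ]
  have sq1 : C.map (powMonoidHom 2) = (C ⊔ B).map n := by
    rw [Subgroup.map_sup]
    have : B.map n = ⊥ := by
      rw [Subgroup.map_eq_bot_iff]
      intro x hx
      exact ((hB x).1 hx).2
    rw [this, sup_bot_eq]
    ext x
    simp only [Subgroup.mem_map, powMonoidHom_apply, hn]
    refine exists_congr fun y => and_congr_right fun hy => ?_
    rw [((hC y).1 hy).2, sq]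
  have sq2 : B.map (powMonoidHom 2) = (C ⊔ B).map δ := by
    rw [Subgroup.map_sup]
    have : C.map δ = ⊥ := by
      rw [Subgroup.map_eq_bot_iff]
      intro x hx
      have := ((hC x).1 hx).2
      simp [MonoidHom.mem_ker, hδ, this]
    rw [this, bot_sup_eq]
    ext x
    simp only [Subgroup.mem_map, powMonoidHom_apply, hδ]
    refine exists_congr fun y => and_congr_right fun hy => ?_
    have := ((hB y).1 hy).2
    have h' : (σ y)⁻¹ = y := by rw [inv_eq_iff_mul_eq_one, mul_comm]; exact this
    rw [div_eq_mul_inv, h', sq]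
  have i1 : (C.map (powMonoidHom 2)).relIndex NA = (C ⊔ B).relIndex A := by
    rw [sq1, ← e1]
    apply relIndex_map_aux
    · intro x hx h1
      exact Subgroup.mem_sup_right ((hB x).2 ⟨hx, h1⟩)
    · exact sup_le hCA hBA
  have i2 : (B.map (powMonoidHom 2)).relIndex D = (C ⊔ B).relIndex A := by
    rw [sq2, ← e2]
    apply relIndex_map_aux
    · intro x hx h1
      rw [hδ, div_eq_one] at h1
      exact Subgroup.mem_sup_left ((hC x).2 ⟨hx, h1.symm⟩)
    · exact sup_le hCA hBA
  have l1 : C.map (powMonoidHom 2) ≤ NA := by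
    rw [sq1, ← e1]; exact Subgroup.map_mono (sup_le hCA hBA)
  have l2 : B.map (powMonoidHom 2) ≤ D := by
    rw [sq2, ← e2]; exact Subgroup.map_mono (sup_le hCA hBA)
  have l3 : NA ≤ C := by
    intro x hx
    obtain ⟨y, hy, rfl⟩ := (hN x).1 hx
    refine (hC _).2 ⟨A.mul_mem hy (hA y hy), ?_⟩
    rw [map_mul, hσ, mul_comm]
  have l4 : D ≤ B := by
    intro x hx
    obtain ⟨y, hy, rfl⟩ := (hD x).1 hx
    refine (hB _).2 ⟨A.div_mem hy (hA y hy), ?_⟩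
    rw [map_div, hσ]; simp
  have m1 := Subgroup.relIndex_mul_relIndex _ _ _ l1 l3
  have m2 := Subgroup.relIndex_mul_relIndex _ _ _ l2 l4
  rw [hc, i1] at m1
  rw [hb, i2] at m2
  obtain ⟨s, -, hs⟩ := (Nat.dvd_prime_pow Nat.prime_two).1 (Dvd.intro _ m1)
  obtain ⟨e, -, he⟩ := (Nat.dvd_prime_pow Nat.prime_two).1 (Dvd.intro_left _ m1)
  obtain ⟨f, -, hf⟩ := (Nat.dvd_prime_pow Nat.prime_two).1 (Dvd.intro_left _ m2)
  refine ⟨e, f, he, hf, ?_⟩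
  rw [hs, he, ← pow_add] at m1
  rw [hs, hf, ← pow_add] at m2
  have := Nat.pow_right_injective (le_refl 2) m1
  have := Nat.pow_right_injective (le_refl 2) m2
  omega

/-- Chevalley's ambiguous class number formula, abstract form. -/
theorem ambiguous_aux {M I : Type*} [CommGroup M] [CommGroup I] (σ : M →* M) (τ : I →* I)
    (hσ : ∀ x, σ (σ x) = x) (hτ : ∀ x, τ (τ x) = x)
    (div : M →* I) (hdiv : ∀ x, div (σ x) = τ (div x))
    (h90M : ∀ x : M, x * σ x = 1 → ∃ y, x = y / σ y)
    (h90I : ∀ x : I, x * τ x = 1 → ∃ y, x = y / τ y)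
    (hnorm : ∀ J : I, ∃ a : M, σ a = a ∧ J * τ J = div a)
    (hunit : ∀ u : M, div u = 1 → σ u = u → ∃ x, x * σ x = u)
    (C B NA D : Subgroup M)
    (hC : ∀ x, x ∈ C ↔ x ∈ div.ker ∧ σ x = x)
    (hB : ∀ x, x ∈ B ↔ x ∈ div.ker ∧ x * σ x = 1)
    (hN : ∀ x, x ∈ NA ↔ ∃ y ∈ div.ker, y * σ y = x)
    (hD : ∀ x, x ∈ D ↔ ∃ y ∈ div.ker, y / σ y = x)
    (e f t : ℕ) (he : NA.relIndex C = 2 ^ e) (hf : D.relIndex B = 2 ^ f)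
    (Mσ : Subgroup M) (hMσ : ∀ x, x ∈ Mσ ↔ σ x = x)
    (Iσ : Subgroup I) (hIσ : ∀ x, x ∈ Iσ ↔ τ x = x)
    (ht : (Mσ.map div).relIndex Iσ = 2 ^ t) :
    Nat.card {c : I ⧸ div.range // c ^ 2 = 1} * 2 ^ f = 2 ^ (t + e) := by
  let n : M →* M := (MonoidHom.id M) * σ
  let δ : M →* M := (MonoidHom.id M) / σ
  let δI : I →* I := (MonoidHom.id I) / τ
  have hn : ∀ x, n x = x * σ x := fun x => rfl
  have hδ : ∀ x, δ x = x / σ x := fun x => rfl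
  have hδI : ∀ x, δI x = x / τ x := fun x => rfl
  let P := div.range
  let U : Subgroup I := P.comap δI
  -- the 2-torsion is U / P
  have hU : ∀ J, J ∈ U ↔ (QuotientGroup.mk J : I ⧸ P) ^ 2 = 1 := by
    intro J
    obtain ⟨a, ha, haJ⟩ := hnorm J
    rw [← QuotientGroup.mk_pow, QuotientGroup.eq_one_iff]
    have h2 : J ^ 2 = δI J * div a := by
      rw [hδI, ← haJ, sq]; simp [div_eq_mul_inv, mul_comm, mul_left_comm]
    have hmem : div a ∈ P := ⟨a, rfl⟩
    rw [h2, Subgroup.mul_mem_cancel_right _ hmem]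
    rfl
  have hPU : P ≤ U := by
    rintro _ ⟨x, rfl⟩
    refine ⟨x / σ x, ?_⟩
    rw [map_div, hdiv]; rfl
  have c1 : Nat.card {c : I ⧸ div.range // c ^ 2 = 1} = P.relIndex U := by
    have : P.relIndex U = Nat.card (U.map (QuotientGroup.mk' P)) := by
      rw [← Subgroup.relIndex_ker, QuotientGroup.ker_mk']
    rw [this]
    apply Nat.card_congr
    refine Equiv.subtypeEquivRight fun c => ?_
    induction c using QuotientGroup.induction_on with
    | H J =>
      rw [← hU]
      constructor
      · intro h; exact ⟨J, h, rfl⟩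
      · rintro ⟨J', h', e'⟩
        have := (hU J').1 h'
        rw [hU]
        change (QuotientGroup.mk J' : I ⧸ P) = QuotientGroup.mk J at e'
        rw [← e']; exact this
  -- chain
  have hIU : Iσ ≤ U := by
    intro x hx
    rw [Subgroup.mem_comap, hδI, (hIσ x).1 hx, div_self']
    exact P.one_mem
  have m1 := Subgroup.relIndex_mul_relIndex P (Iσ ⊔ P) U le_sup_right (sup_le hIU hPU)
  have m2 : P.relIndex (Iσ ⊔ P) = (P ⊓ Iσ).relIndex Iσ := by
    rw [Subgroup.relIndex_sup_right, Subgroup.inf_relIndex_right]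
  have hsub : Mσ.map div ≤ P ⊓ Iσ := by
    rintro _ ⟨x, hx, rfl⟩
    refine ⟨⟨x, rfl⟩, (hIσ _).2 ?_⟩
    rw [← hdiv, (hMσ x).1 hx]
  have m3 := Subgroup.relIndex_mul_relIndex (Mσ.map div) (P ⊓ Iσ) Iσ hsub inf_le_right
  -- [P^G : P_K] = [B : D]
  let Y : Subgroup M := B.comap δ
  have hYP : Y.map div = P ⊓ Iσ := by
    apply le_antisymm
    · rintro _ ⟨x, hx, rfl⟩
      refine ⟨⟨x, rfl⟩, (hIσ _).2 ?_⟩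
      have h1 := ((hB _).1 hx).1
      rw [MonoidHom.mem_ker, hδ, map_div, div_eq_one, hdiv] at h1
      exact h1.symm
    · rintro _ ⟨⟨x, rfl⟩, h2⟩
      refine ⟨x, (hB _).2 ⟨?_, ?_⟩, rfl⟩
      · rw [MonoidHom.mem_ker, hδ, map_div, div_eq_one, hdiv]
        exact ((hIσ _).1 h2).symm
      · rw [hδ, map_div, hσ]; simp
  have hker : div.ker ≤ Y := by
    intro x hx
    refine (hB _).2 ⟨?_, ?_⟩
    · rw [MonoidHom.mem_ker] at hx ⊢
      rw [hδ, map_div, hdiv, hx]; simp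
    · rw [hδ, map_div, hσ]; simp
  have hMY : Mσ ≤ Y := by
    intro x hx
    rw [Subgroup.mem_comap, hδ, (hMσ x).1 hx, div_self']
    exact B.one_mem
  have hMm : (Mσ ⊔ div.ker).map div = Mσ.map div := by
    rw [Subgroup.map_sup, (Subgroup.map_eq_bot_iff _).2 le_rfl, sup_bot_eq]
  have m4 : (Mσ.map div).relIndex (P ⊓ Iσ) = (Mσ ⊔ div.ker).relIndex Y := by
    rw [← hYP, ← hMm]
    exact relIndex_map_aux _ _ _ (fun x _ h => Subgroup.mem_sup_right h) (sup_le hMY hker)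
  have hYB : Y.map δ = B := by
    apply le_antisymm
    · rintro _ ⟨x, hx, rfl⟩; exact hx
    · intro x hx
      obtain ⟨y, hy⟩ := h90M x ((hB x).1 hx).2
      exact ⟨y, show δ y ∈ B by rw [hδ, ← hy]; exact hx, hy.symm⟩
  have hMD : (Mσ ⊔ div.ker).map δ = D := by
    rw [Subgroup.map_sup]
    have : Mσ.map δ = ⊥ := by
      rw [Subgroup.map_eq_bot_iff]
      intro x hx
      have := (hMσ x).1 hx
      simp [MonoidHom.mem_ker, hδ, this]
    rw [this, bot_sup_eq]
    ext x; simp only [Subgroup.mem_map, hD, hδ]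
  have m5 : (Mσ ⊔ div.ker).relIndex Y = 2 ^ f := by
    rw [← hf, ← hYB, ← hMD]
    symm
    apply relIndex_map_aux
    · intro x _ h1
      rw [hδ, div_eq_one] at h1
      exact Subgroup.mem_sup_left ((hMσ x).2 h1.symm)
    · exact sup_le hMY hker
  -- [U : I^G P] = [C : NA]
  let X : Subgroup M := C.comap n
  have m6 : (Iσ ⊔ P).relIndex U = ((Iσ ⊔ P).map δI).relIndex (U.map δI) := by
    symm
    apply relIndex_map_aux
    · intro x _ h1
      rw [hδI, div_eq_one] at h1
      exact Subgroup.mem_sup_left ((hIσ x).2 h1.symm)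
    · exact sup_le hIU hPU
  have hUX : U.map δI = X.map div := by
    apply le_antisymm
    · rintro _ ⟨J, ⟨x, hx⟩, rfl⟩
      refine ⟨x, (hC _).2 ⟨?_, ?_⟩, hx⟩
      · rw [MonoidHom.mem_ker, hn, map_mul, hdiv, hx, hδI, map_div, hτ]; simp
      · rw [hn, map_mul, hσ, mul_comm]
    · rintro _ ⟨x, hx, rfl⟩
      have h1 := ((hC _).1 hx).1
      rw [MonoidHom.mem_ker, hn, map_mul, hdiv] at h1
      obtain ⟨J, hJ⟩ := h90I _ h1
      refine ⟨J, ⟨x, ?_⟩, hJ.symm⟩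
      rw [hJ]; rfl
  have hIP : (Iσ ⊔ P).map δI = (δ.range ⊔ div.ker).map div := by
    rw [Subgroup.map_sup, Subgroup.map_sup, (Subgroup.map_eq_bot_iff (f := div) _).2 le_rfl, sup_bot_eq]
    have : Iσ.map δI = ⊥ := by
      rw [Subgroup.map_eq_bot_iff]
      intro x hx
      have := (hIσ x).1 hx
      simp [MonoidHom.mem_ker, hδI, this]
    rw [this, bot_sup_eq]
    ext x
    constructor
    · rintro ⟨_, ⟨y, rfl⟩, rfl⟩
      exact ⟨δ y, ⟨y, rfl⟩, by rw [hδ, map_div, hdiv, hδI]⟩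
    · rintro ⟨_, ⟨y, rfl⟩, rfl⟩
      exact ⟨div y, ⟨y, rfl⟩, by rw [hδ, map_div, hdiv, hδI]⟩
  have hδX : δ.range ≤ X := by
    rintro _ ⟨y, rfl⟩
    rw [Subgroup.mem_comap]
    have : n (δ y) = 1 := by rw [hn, hδ, map_div, hσ]; simp
    rw [this]; exact C.one_mem
  have hkX : div.ker ≤ X := by
    intro x hx
    rw [MonoidHom.mem_ker] at hx
    refine (hC _).2 ⟨?_, ?_⟩
    · rw [MonoidHom.mem_ker, hn, map_mul, hdiv, hx]; simp
    · rw [hn, map_mul, hσ, mul_comm]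
  have m7 : ((δ.range ⊔ div.ker).map div).relIndex (X.map div) = (δ.range ⊔ div.ker).relIndex X :=
    relIndex_map_aux _ _ _ (fun x _ h => Subgroup.mem_sup_right h) (sup_le hδX hkX)
  have hXC : X.map n = C := by
    apply le_antisymm
    · rintro _ ⟨x, hx, rfl⟩; exact hx
    · intro u hu
      obtain ⟨x, hx⟩ := hunit u ((hC u).1 hu).1 ((hC u).1 hu).2
      exact ⟨x, show n x ∈ C by rw [hn, hx]; exact hu, hx⟩
  have hDN : (δ.range ⊔ div.ker).map n = NA := by
    rw [Subgroup.map_sup]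
    have : δ.range.map n = ⊥ := by
      rw [Subgroup.map_eq_bot_iff]
      rintro _ ⟨y, rfl⟩
      rw [MonoidHom.mem_ker, hn, hδ, map_div, hσ]; simp
    rw [this, bot_sup_eq]
    ext x; simp only [Subgroup.mem_map, hN, hn]
  have m8 : (δ.range ⊔ div.ker).relIndex X = 2 ^ e := by
    rw [← he, ← hXC, ← hDN]
    symm
    apply relIndex_map_aux
    · intro x _ h1
      rw [hn] at h1
      obtain ⟨y, rfl⟩ := h90M x h1
      exact Subgroup.mem_sup_left ⟨y, rfl⟩
    · exact sup_le hδX hkX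
  rw [m6, hUX, hIP, m7, m8, m2] at m1
  rw [m4, m5, ht] at m3
  rw [c1, ← m1, pow_add, ← m3]
  ring

theorem nsmul_index_prod_aux (F T : Type*) [AddCommGroup F] [AddCommGroup T] [Module.Finite ℤ F]
    [Module.Free ℤ F] [Finite T] :
    (nsmulAddMonoidHom (α := F × T) 2).range.index
      = 2 ^ (Module.finrank ℤ (F × T)) * Nat.card (nsmulAddMonoidHom (α := F × T) 2).ker := by
  have h1 : (nsmulAddMonoidHom (α := F × T) 2).range =
      (nsmulAddMonoidHom (α := F) 2).range.prod (nsmulAddMonoidHom (α := T) 2).range := by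
    ext ⟨x, y⟩
    simp [AddSubgroup.mem_prod, AddMonoidHom.mem_range, Prod.ext_iff]
  have h2 : (nsmulAddMonoidHom (α := F × T) 2).ker =
      (nsmulAddMonoidHom (α := F) 2).ker.prod (nsmulAddMonoidHom (α := T) 2).ker := by
    ext ⟨x, y⟩
    simp [AddSubgroup.mem_prod, AddMonoidHom.mem_ker, Prod.ext_iff]
  have h3 : (nsmulAddMonoidHom (α := F) 2).ker = ⊥ := by
    rw [AddMonoidHom.ker_eq_bot_iff]
    intro x y h
    have hh : (2 : ℤ) • x = (2 : ℤ) • y := by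
      have : (2 : ℕ) • x = (2 : ℕ) • y := h
      exact_mod_cast this
    exact smul_right_injective F (two_ne_zero) hh
  have h4 : Module.finrank ℤ (F × T) = Module.finrank ℤ F := by
    have hT : Module.finrank ℤ T = 0 := by
      have : Module.IsTorsion ℤ T := by
        intro x
        refine ⟨⟨(addOrderOf x : ℤ), ?_⟩, ?_⟩
        · rw [mem_nonZeroDivisors_iff_ne_zero]
          exact_mod_cast (addOrderOf_pos x).ne'
        · change (addOrderOf x : ℤ) • x = 0
          rw [natCast_zsmul]; exact addOrderOf_nsmul_eq_zero x
      exact Module.finrank_eq_zero_iff_isTorsion.2 this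
    have := Submodule.finrank_quotient_add_finrank (R := ℤ) (LinearMap.ker (LinearMap.fst ℤ F T))
    rw [(LinearMap.quotKerEquivOfSurjective (LinearMap.fst ℤ F T) LinearMap.fst_surjective).finrank_eq] at this
    have e : Module.finrank ℤ (LinearMap.ker (LinearMap.fst ℤ F T)) = Module.finrank ℤ T := by
      rw [LinearMap.ker_fst]
      exact (LinearMap.finrank_range_of_inj LinearMap.inr_injective)
    omega
  rw [h1, AddSubgroup.index_prod, h2, h4, h3, AddSubgroup.index_range_nsmul]
  congr 1
  rw [AddSubgroup.index_range]
  apply Nat.card_congr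
  exact (Equiv.ofBijective (fun x : ((⊥ : AddSubgroup F).prod (nsmulAddMonoidHom (α := T) 2).ker) =>
    (⟨x.1.2, x.2.2⟩ : (nsmulAddMonoidHom (α := T) 2).ker)) ⟨by
      rintro ⟨⟨a, b⟩, h⟩ ⟨⟨c, d⟩, h'⟩ hh
      have ha : a = 0 := by simpa using h.1
      have hc : c = 0 := by simpa using h'.1
      simp at hh
      subst ha hc hh
      rfl, fun ⟨b, hb⟩ => ⟨⟨⟨0, b⟩, ⟨by simp, hb⟩⟩, rfl⟩⟩).symm

theorem nsmul_index_aux (X : Type*) [AddCommGroup X] [hX : Module.Finite ℤ X] :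
    (nsmulAddMonoidHom (α := X) 2).range.index
      = 2 ^ (Module.finrank ℤ X) * Nat.card (nsmulAddMonoidHom (α := X) 2).ker := by
  have : AddGroup.FG X := Module.Finite.iff_addGroup_fg.1 hX
  obtain ⟨n, ι, _, p, hp, e, ⟨g⟩⟩ := AddCommGroup.equiv_free_prod_directSum_zmod X
  have : ∀ i, NeZero (p i ^ e i) := fun i => ⟨pow_ne_zero _ (hp i).ne_zero⟩
  have : Finite (DirectSum ι fun i : ι => ZMod (p i ^ e i)) := by
    classical
    exact Finite.of_equiv _ (DirectSum.addEquivProd (fun i => ZMod (p i ^ e i))).symm.toEquiv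
  have h := nsmul_index_prod_aux (Fin n →₀ ℤ) (DirectSum ι fun i : ι => ZMod (p i ^ e i))
  rw [(g.toIntLinearEquiv).finrank_eq]
  have h1 : (nsmulAddMonoidHom (α := X) 2).range.index = _ :=
    (AddSubgroup.index_map_equiv (nsmulAddMonoidHom (α := X) 2).range g).symm
  rw [AddEquiv.map_range_nsmulAddMonoidHom] at h1
  rw [h1, h]
  congr 1
  apply Nat.card_congr
  refine (g.toEquiv.subtypeEquiv fun x => ?_).symm
  simp only [AddMonoidHom.mem_ker, nsmulAddMonoidHom_apply]
  change _ ↔ 2 • g x = 0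
  rw [← map_nsmul]; exact (map_eq_zero_iff g g.injective).symm

theorem sq_index_aux (X : Type*) [CommGroup X] [Module.Finite ℤ (Additive X)]
    (h2 : Nat.card {x : X // x ^ 2 = 1} = 2) :
    (powMonoidHom (α := X) 2).range.index = 2 ^ (Module.finrank ℤ (Additive X) + 1) := by
  have := nsmul_index_aux (Additive X)
  have h3 : Nat.card (nsmulAddMonoidHom (α := Additive X) 2).ker = 2 := h2
  rw [h3] at this
  rw [pow_succ, ← this]
  rfl

theorem sq_relIndex_aux {M : Type*} [CommGroup M] (C : Subgroup M) [Module.Finite ℤ (Additive C)]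
    (h2 : Nat.card {x : C // x ^ 2 = 1} = 2) :
    (C.map (powMonoidHom 2)).relIndex C = 2 ^ (Module.finrank ℤ (Additive C) + 1) := by
  rw [← sq_index_aux C h2, Subgroup.relIndex]
  congr 1
  ext x
  simp only [Subgroup.mem_subgroupOf, Subgroup.mem_map, MonoidHom.mem_range, powMonoidHom_apply]
  constructor
  · rintro ⟨y, hy, h⟩; exact ⟨⟨y, hy⟩, Subtype.ext h⟩
  · rintro ⟨y, rfl⟩; exact ⟨y, y.2, rfl⟩

/-- rank of the norm-one part. -/
theorem finrank_norm_one_aux {M : Type*} [CommGroup M] (σ : M →* M) (hσ : ∀ x, σ (σ x) = x)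
    (A : Subgroup M) (hA : ∀ x ∈ A, σ x ∈ A) [Module.Finite ℤ (Additive A)]
    (C B : Subgroup M)
    (hC : ∀ x, x ∈ C ↔ x ∈ A ∧ σ x = x)
    (hB : ∀ x, x ∈ B ↔ x ∈ A ∧ x * σ x = 1) :
    Module.Finite ℤ (Additive C) ∧ Module.Finite ℤ (Additive B) ∧
    Module.finrank ℤ (Additive B) + Module.finrank ℤ (Additive C) = Module.finrank ℤ (Additive A) := by
  have hCA : C ≤ A := fun x hx => ((hC x).1 hx).1
  have hBA : B ≤ A := fun x hx => ((hB x).1 hx).1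
  let iC : Additive C →ₗ[ℤ] Additive A := (Subgroup.inclusion hCA).toAdditive.toIntLinearMap
  let iB : Additive B →ₗ[ℤ] Additive A := (Subgroup.inclusion hBA).toAdditive.toIntLinearMap
  have jC : Function.Injective iC := Subgroup.inclusion_injective hCA
  have jB : Function.Injective iB := Subgroup.inclusion_injective hBA
  have fC : Module.Finite ℤ (Additive C) := Module.Finite.of_injective iC jC
  have fB : Module.Finite ℤ (Additive B) := Module.Finite.of_injective iB jB
  refine ⟨fC, fB, ?_⟩
  let n0 : A →* C :=
    { toFun := fun x => ⟨x * σ x, (hC _).2 ⟨A.mul_mem x.2 (hA _ x.2), by rw [map_mul, hσ, mul_comm]⟩⟩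
      map_one' := Subtype.ext (by simp)
      map_mul' := fun x y => Subtype.ext (by
        change (x * y : M) * σ (x * y) = (x * σ x) * (y * σ y)
        rw [map_mul]; exact mul_mul_mul_comm _ _ _ _) }
  let n : Additive A →ₗ[ℤ] Additive C := n0.toAdditive.toIntLinearMap
  have e1 := Submodule.finrank_quotient_add_finrank (LinearMap.ker n)
  rw [(LinearMap.quotKerEquivRange n).finrank_eq] at e1
  have e2 := Submodule.finrank_quotient_add_finrank (LinearMap.range n)
  have e3 : Module.finrank ℤ (Additive C ⧸ LinearMap.range n) = 0 := by
    rw [Module.finrank_eq_zero_iff_isTorsion]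
    intro x
    obtain ⟨x, rfl⟩ := Submodule.Quotient.mk_surjective _ x
    refine ⟨⟨2, by rw [mem_nonZeroDivisors_iff_ne_zero]; norm_num⟩, ?_⟩
    change (2 : ℤ) • (Submodule.Quotient.mk x : Additive C ⧸ LinearMap.range n) = 0
    rw [← Submodule.Quotient.mk_smul, Submodule.Quotient.mk_eq_zero]
    refine ⟨iC x, ?_⟩
    obtain ⟨y, hy⟩ := Additive.ofMul.surjective x
    subst hy
    have : n0 (Subgroup.inclusion hCA y) = y ^ (2 : ℤ) := by
      ext
      have := ((hC _).1 y.2).2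
      simp [n0, this, zpow_ofNat, sq]
    exact this
  have e4 : LinearMap.range iB = LinearMap.ker n := by
    ext x
    obtain ⟨y, hy⟩ := Additive.ofMul.surjective x
    subst hy
    rw [LinearMap.mem_ker]
    constructor
    · rintro ⟨z, hz⟩
      obtain ⟨z, rfl⟩ := Additive.ofMul.surjective z
      have hz : Subgroup.inclusion hBA z = y := hz
      change n0 y = 1
      ext
      rw [← hz]
      exact ((hB _).1 z.2).2
    · intro h
      have h : n0 y = 1 := h
      have h' : (y : M) * σ y = 1 := congrArg Subtype.val h
      exact ⟨Additive.ofMul ⟨y, (hB _).2 ⟨y.2, h'⟩⟩, rfl⟩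
  have e5 : Module.finrank ℤ (Additive B) = Module.finrank ℤ (LinearMap.ker n) := by
    rw [← e4]; exact (LinearMap.finrank_range_of_inj jB).symm
  omega
open NumberField

theorem cyc8_pid (K : Type*) [Field K] [NumberField K] [hK : IsCyclotomicExtension {8} ℚ K] :
    IsPrincipalIdealRing (𝓞 K) := by
  have hK' : IsCyclotomicExtension {2 ^ (2 + 1)} ℚ K := by simpa using hK
  have h2 : Fact (Nat.Prime 2) := ⟨Nat.prime_two⟩
  have hfin : Module.finrank ℚ K = 4 := by
    rw [IsCyclotomicExtension.finrank (n := 8) K (Polynomial.cyclotomic.irreducible_rat (by simp))]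
    decide
  have hr2 : InfinitePlace.nrComplexPlaces K = 2 := by
    rw [IsCyclotomicExtension.Rat.nrComplexPlaces_eq_totient_div_two 8]
    decide
  have hdisc : NumberField.discr K = 256 := by
    rw [IsCyclotomicExtension.Rat.discr_prime_pow_succ 2 2 K]
    norm_num
  have hζ := IsCyclotomicExtension.zeta_spec (2 ^ (2 + 1)) ℚ K
  apply RingOfIntegers.isPrincipalIdealRing_of_isPrincipal_of_pow_le_of_mem_primesOver_of_mem_Icc
  intro p hp hpp P hP _
  rw [hfin, hr2, hdisc] at hp
  have hs : √(|((256 : ℤ) : ℝ)|) = 16 := by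
    rw [show |((256 : ℤ) : ℝ)| = 16 ^ 2 by norm_num]
    exact Real.sqrt_sq (by norm_num)
  have hM : ⌊(4 / Real.pi) ^ 2 * ((Nat.factorial 4 : ℝ) / (4 : ℕ) ^ 4 * √(|((256 : ℤ) : ℝ)|))⌋₊ < 3 := by
    rw [Nat.floor_lt (by positivity), hs]
    have h3 := Real.pi_gt_three
    have h4 : 4 / Real.pi < 4 / 3 := by gcongr
    have h5 : (4 / Real.pi) ^ 2 < (4 / 3) ^ 2 := by gcongr
    have : (Nat.factorial 4 : ℝ) = 24 := by norm_num [Nat.factorial]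
    rw [this]
    push_cast
    nlinarith
  have hp2 : p = 2 := by
    have := (Finset.mem_Icc.1 hp).2
    have := hpp.two_le
    push_cast at *
    omega
  subst hp2
  have := hP.1
  have := hP.2
  rw [IsCyclotomicExtension.Rat.eq_span_zeta_sub_one_of_liesOver 2 2 K hζ P]
  exact ⟨⟨_, rfl⟩⟩

theorem cyc8_finrank (K : Type*) [Field K] [NumberField K] [hK : IsCyclotomicExtension {8} ℚ K] :
    Module.finrank ℚ K = 4 := by
  rw [IsCyclotomicExtension.finrank (n := 8) K (Polynomial.cyclotomic.irreducible_rat (by simp))]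
  decide

theorem cyc8_rank (K : Type*) [Field K] [NumberField K] [hK : IsCyclotomicExtension {8} ℚ K] :
    Module.finrank ℤ (Additive (𝓞 K)ˣ) = 1 := by
  rw [NumberField.Units.finrank_eq, Units.rank]
  have hr2 : InfinitePlace.nrComplexPlaces K = 2 := by
    rw [IsCyclotomicExtension.Rat.nrComplexPlaces_eq_totient_div_two 8]
    decide
  have := InfinitePlace.card_add_two_mul_card_eq_rank K
  rw [cyc8_finrank K, hr2] at this
  rw [InfinitePlace.card_eq_nrRealPlaces_add_nrComplexPlaces]
  omega

theorem cyc8_ncard (K : Type*) [Field K] [NumberField K] [hK : IsCyclotomicExtension {8} ℚ K]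
    (q : ℕ) (hq : q.Prime) (h7 : q % 8 = 7) :
    (Ideal.primesOver (Ideal.span {(q : ℤ)}) (𝓞 K)).ncard = 2 := by
  have : Fact q.Prime := ⟨hq⟩
  have hm : ¬ q ∣ 8 := by
    intro h
    have : q ∣ 2 := hq.dvd_of_dvd_pow (n := 3) (by simpa using h)
    have := (Nat.prime_dvd_prime_iff_eq hq Nat.prime_two).1 this
    omega
  have hgal : IsGalois ℚ K := IsCyclotomicExtension.isGalois {8} ℚ K
  have hmax : (Ideal.span {(q : ℤ)}).IsMaximal := Int.ideal_span_isMaximal_of_prime q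
  have h := Ideal.ncard_primesOver_mul_ramificationIdxIn_mul_inertiaDegIn
    (Ideal.span {(q : ℤ)}) (𝓞 K) Gal(K/ℚ)
  rw [IsCyclotomicExtension.Rat.ramificationIdxIn_eq_of_not_dvd q K (m := 8) hm,
    IsCyclotomicExtension.Rat.inertiaDegIn_eq_of_not_dvd q K (m := 8) hm,
    IsGaloisGroup.card_eq_finrank Gal(K/ℚ) ℚ K, cyc8_finrank K] at h
  have ho : orderOf (q : ZMod 8) = 2 := by
    have : (q : ZMod 8) = 7 := by
      have := (ZMod.natCast_eq_natCast_iff' q 7 8).2 (by omega)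
      simpa using this
    rw [this]
    apply orderOf_eq_prime <;> decide
  rw [ho] at h
  omega

theorem cyc8_notMem_sq (K : Type*) [Field K] [NumberField K] [hK : IsCyclotomicExtension {8} ℚ K]
    (q : ℕ) (hq : q.Prime) (h7 : q % 8 = 7) (P : Ideal (𝓞 K)) [P.IsPrime]
    (hP : (q : 𝓞 K) ∈ P) : (q : 𝓞 K) ∉ P ^ 2 := by
  have : Fact q.Prime := ⟨hq⟩
  have hm : ¬ q ∣ 8 := by
    intro h
    have : q ∣ 2 := hq.dvd_of_dvd_pow (n := 3) (by simpa using h)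
    have := (Nat.prime_dvd_prime_iff_eq hq Nat.prime_two).1 this
    omega
  have hmax : (Ideal.span {(q : ℤ)}).IsMaximal := Int.ideal_span_isMaximal_of_prime q
  have hl : P.LiesOver (Ideal.span {(q : ℤ)}) := by
    constructor
    apply hmax.eq_of_le
    · exact (Ideal.IsPrime.under ℤ P).ne_top
    · rw [Ideal.span_singleton_le_iff_mem, Ideal.mem_comap]
      simpa using hP
  have h := IsCyclotomicExtension.Rat.ramificationIdx_eq_of_not_dvd q K P (m := 8) hm
  intro hcon
  have hP0 : P ≠ ⊥ := by
    rintro rfl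
    rw [Ideal.mem_bot] at hP
    exact hq.ne_zero (by exact_mod_cast hP)
  have hmap : (Ideal.span {(q : ℤ)}).map (algebraMap ℤ (𝓞 K)) ≠ ⊥ :=
    Ideal.map_ne_bot_of_ne_bot (by simp [hq.ne_zero])
  rw [Ideal.IsDedekindDomain.ramificationIdx_eq_multiplicity (Ideal.span {(q : ℤ)}) P hmap] at h
  have hf : FiniteMultiplicity P ((Ideal.span {(q : ℤ)}).map (algebraMap ℤ (𝓞 K))) :=
    FiniteMultiplicity.of_prime_left (Ideal.prime_of_isPrime hP0 inferInstance) hmap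
  apply hf.not_pow_dvd_of_multiplicity_lt (m := 2) (by omega)
  rw [Ideal.dvd_iff_le, Ideal.map_span, Set.image_singleton, Ideal.span_singleton_le_iff_mem]
  simpa using hcon

theorem cyc8_d_notMem_sq (K : Type*) [Field K] [NumberField K] [hK : IsCyclotomicExtension {8} ℚ K]
    (d : ℕ) (hd : Squarefree d) (hp : ∀ p ∈ d.primeFactors, p % 8 = 7)
    (P : Ideal (𝓞 K)) [P.IsPrime] (hP : (d : 𝓞 K) ∈ P) : (d : 𝓞 K) ∉ P ^ 2 := by
  have hd0 : d ≠ 0 := hd.ne_zero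
  obtain ⟨q, hqd, hqP⟩ : ∃ q ∈ d.primeFactors, (q : 𝓞 K) ∈ P := by
    rw [← Nat.prod_primeFactors_of_squarefree hd, Nat.cast_prod] at hP
    exact (Ideal.IsPrime.prod_mem_iff (p := P)).1 hP
  have hq := Nat.prime_of_mem_primeFactors hqd
  obtain ⟨d', rfl⟩ := Nat.dvd_of_mem_primeFactors hqd
  have hco : Nat.Coprime q d' := Nat.coprime_of_squarefree_mul hd
  have hd'P : (d' : 𝓞 K) ∉ P := by
    intro h
    have h1 := (Nat.isCoprime_iff_coprime.2 hco)
    obtain ⟨a, b, hab⟩ := h1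
    apply ‹P.IsPrime›.ne_top
    rw [Ideal.eq_top_iff_one]
    have : (1 : 𝓞 K) = a * q + b * d' := by exact_mod_cast hab.symm
    rw [this]
    exact P.add_mem (P.mul_mem_left _ hqP) (P.mul_mem_left _ h)
  intro hcon
  apply cyc8_notMem_sq K q hq (hp q hqd) P hqP
  have hP0 : P ≠ ⊥ := by
    rintro rfl
    rw [Ideal.mem_bot] at hqP
    exact hq.ne_zero (by exact_mod_cast hqP)
  push_cast at hcon
  exact ((Ideal.IsPrime.mem_pow_mul (I := P) hcon).resolve_right hd'P)
end PartM1

section PartM2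
open NumberField

theorem cyc8_d_notSquare (K : Type*) [Field K] [NumberField K]
    [hK : IsCyclotomicExtension {8} ℚ K]
    (d : ℕ) (hd2 : 2 < d) (hd : Squarefree d) (hp : ∀ p ∈ d.primeFactors, p % 8 = 7) :
    ¬ IsSquare (d : K) := by
  rintro ⟨x, hx⟩
  have hxi : IsIntegral ℤ x := by
    apply IsIntegral.of_pow two_pos
    rw [sq, ← hx]
    exact (map_natCast (algebraMap ℤ K) d) ▸ isIntegral_algebraMap
  obtain ⟨y, rfl⟩ : ∃ y : 𝓞 K, (y : K) = x := ⟨⟨x, hxi⟩, rfl⟩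
  have hy : (d : 𝓞 K) = y * y := by
    apply RingOfIntegers.ext; simpa using hx
  have hnu : ¬ IsUnit (d : 𝓞 K) := by
    intro h
    obtain ⟨z, hz⟩ := h.exists_right_inv
    have hq : d.primeFactors.Nonempty := by
      rw [Nat.nonempty_primeFactors]; omega
    obtain ⟨q, hq⟩ := hq
    have := cyc8_ncard K q (Nat.prime_of_mem_primeFactors hq) (hp q hq)
    have hne : (Ideal.primesOver (Ideal.span {(q : ℤ)}) (𝓞 K)).Nonempty := by
      apply Set.nonempty_of_ncard_ne_zero; omega
    obtain ⟨P, hP⟩ := hne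
    have hP1 := hP.1
    have hP2 := hP.2
    apply hP1.ne_top
    have hqP : (q : 𝓞 K) ∈ P := by
      have : (q : ℤ) ∈ P.under ℤ := by
        rw [← hP2.over]; exact Ideal.mem_span_singleton_self _
      simpa [Ideal.mem_comap] using this
    apply Ideal.eq_top_of_isUnit_mem P _ h
    obtain ⟨e, he⟩ := Nat.dvd_of_mem_primeFactors hq
    rw [he, Nat.cast_mul]
    exact P.mul_mem_right _ hqP
  obtain ⟨P, hP, hdP⟩ := exists_max_ideal_of_mem_nonunits hnu
  have hP' := hP.isPrime
  apply cyc8_d_notMem_sq K d hd hp P hdP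
  rw [hy] at hdP ⊢
  rw [sq]
  have : y ∈ P := by rcases hP'.mem_or_mem hdP with h | h <;> exact h
  exact Ideal.mul_mem_mul this this

theorem cyc8_nonsq (K : Type*) [Field K] [NumberField K] [hK : IsCyclotomicExtension {8} ℚ K]
    (ζ : K) (hζ : ζ = IsCyclotomicExtension.zeta 8 ℚ K) :
    ¬ IsSquare ζ ∧ ¬ IsSquare (1 + (ζ - ζ ^ 3)) ∧ ¬ IsSquare (ζ * (1 + (ζ - ζ ^ 3))) := by
  have hp : IsPrimitiveRoot ζ 8 := hζ ▸ IsCyclotomicExtension.zeta_spec 8 ℚ K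
  have h4 : ζ ^ 4 = -1 := by
    have h8 := hp.pow_eq_one
    have : (ζ ^ 4 - 1) * (ζ ^ 4 + 1) = 0 := by linear_combination h8
    rcases mul_eq_zero.1 this with h | h
    · exact absurd (sub_eq_zero.1 h) (hp.pow_ne_one_of_pos_of_lt (by norm_num) (by norm_num))
    · linear_combination h
  have hirr : Irreducible (Polynomial.cyclotomic 8 ℚ) :=
    Polynomial.cyclotomic.irreducible_rat (by simp)
  have hext : ∀ f g : K →ₐ[ℚ] K, f ζ = g ζ → f = g := by
    intro f g h
    apply (hp.powerBasis ℚ).algHom_ext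
    simpa using h
  have haut : ∀ k : ℕ, Nat.Coprime k 8 → ∃ f : K →ₐ[ℚ] K, f ζ = ζ ^ k := by
    intro k hk
    have := hp.pow_of_coprime k hk
    refine ⟨(IsCyclotomicExtension.fromZetaAut this hirr : K ≃ₐ[ℚ] K), ?_⟩
    have h := IsCyclotomicExtension.fromZetaAut_spec this hirr
    rw [← hζ] at h
    exact h
  obtain ⟨τ, hτ⟩ := haut 5 (by decide)
  obtain ⟨σ, hσ⟩ := haut 3 (by decide)
  have hτ' : τ ζ = -ζ := by rw [hτ]; linear_combination ζ * h4
  have hττ : ∀ x, τ (τ x) = x := by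
    intro x
    have : τ.comp τ = AlgHom.id ℚ K := by
      apply hext; simp [hτ']
    exact congrArg (fun f => f x) this
  have hσσ : ∀ x, σ (σ x) = x := by
    intro x
    have : σ.comp σ = AlgHom.id ℚ K := by
      apply hext
      simp only [AlgHom.comp_apply, hσ, map_pow, AlgHom.id_apply]
      linear_combination (ζ ^ 5 - ζ) * h4
    exact congrArg (fun f => f x) this
  have hz0 : ζ ≠ 0 := hp.ne_zero (by norm_num)
  have h2 : (2 : K) ≠ 0 := two_ne_zero
  have key1 : ∀ a x : K, a ≠ 0 → τ a = -a → a ≠ x * x := by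
    intro a x ha0 ha hx
    have hx0 : x ≠ 0 := by rintro rfl; apply ha0; rw [hx]; ring
    have h1 : (τ x - ζ ^ 2 * x) * (τ x + ζ ^ 2 * x) = 0 := by
      have : τ x * τ x = - (x * x) := by rw [← map_mul, ← hx, ha]
      linear_combination this - x ^ 2 * h4
    have h3 : τ (τ x) = - x := by
      rcases mul_eq_zero.1 h1 with h | h
      · have e : τ x = ζ ^ 2 * x := by linear_combination h
        rw [e, map_mul, map_pow, hτ', e]; linear_combination x * h4
      · have e : τ x = -(ζ ^ 2 * x) := by linear_combination h
        rw [e, map_neg, map_mul, map_pow, hτ', e]; linear_combination x * h4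
    rw [hττ] at h3
    have : 2 * x = 0 := by linear_combination h3
    rcases mul_eq_zero.1 this with h | h
    · exact h2 h
    · exact hx0 h
  have hw2 : (ζ - ζ ^ 3) ^ 2 = 2 := by linear_combination (-2 + ζ ^ 2) * h4
  have hw0 : ζ - ζ ^ 3 ≠ 0 := by
    intro h; rw [h] at hw2; apply h2; rw [← hw2]; ring
  have key2 : ∀ x : K, 1 + ζ ^ 2 ≠ x * x := by
    intro x hx
    have hy : (x * σ x) ^ 2 = 2 := by
      have : σ x * σ x = 1 + (ζ ^ 3) ^ 2 := by rw [← map_mul, ← hx, map_add, map_pow, hσ, map_one]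
      calc (x * σ x) ^ 2 = (x * x) * (σ x * σ x) := by ring
        _ = 2 := by rw [← hx, this]; linear_combination (ζ ^ 4 + ζ ^ 2 - 1) * h4
    have hyσ : σ (x * σ x) = x * σ x := by rw [map_mul, hσσ, mul_comm]
    have hwσ : σ (ζ - ζ ^ 3) = -(ζ - ζ ^ 3) := by
      rw [map_sub, map_pow, hσ]; linear_combination (ζ - ζ ^ 5) * h4
    set y := x * σ x
    have : (y - (ζ - ζ ^ 3)) * (y + (ζ - ζ ^ 3)) = 0 := by linear_combination hy - hw2
    have hy0 : y ≠ 0 := by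
      intro h; rw [h] at hy; apply h2; rw [← hy]; ring
    have h3 : σ y = - y := by
      rcases mul_eq_zero.1 this with h | h
      · have e : y = ζ - ζ ^ 3 := by linear_combination h
        rw [e, hwσ]
      · have e : y = -(ζ - ζ ^ 3) := by linear_combination h
        rw [e, map_neg, hwσ]
    rw [hyσ] at h3
    have : 2 * y = 0 := by linear_combination h3
    rcases mul_eq_zero.1 this with h | h
    · exact h2 h
    · exact hy0 h
  have heps : (1 + (ζ - ζ ^ 3)) * (2 * (1 + ζ ^ 2)) = (1 + (ζ - ζ ^ 3) + ζ ^ 2) ^ 2 := by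
    linear_combination (1 - ζ ^ 2) * h4
  have hne : 1 + ζ ^ 2 ≠ 0 := by
    intro h
    have : ζ ^ 4 = 1 := by linear_combination (ζ ^ 2 - 1) * h
    rw [h4] at this
    apply h2; linear_combination -this
  have heps0 : 1 + (ζ - ζ ^ 3) ≠ 0 := by
    intro h
    have : (1 + (ζ - ζ ^ 3)) * ((ζ - ζ ^ 3) - 1) = 1 := by linear_combination hw2
    rw [h, zero_mul] at this
    exact zero_ne_one this
  refine ⟨?_, ?_, ?_⟩
  · rintro ⟨x, hx⟩; exact key1 ζ x hz0 hτ' hx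
  · rintro ⟨x, hx⟩
    have hx0 : x ≠ 0 := by
      rintro rfl
      exact heps0 (by rw [hx]; ring)
    apply key2 ((1 + (ζ - ζ ^ 3) + ζ ^ 2) / ((ζ - ζ ^ 3) * x))
    rw [div_mul_div_comm, eq_div_iff (mul_ne_zero (mul_ne_zero hw0 hx0) (mul_ne_zero hw0 hx0))]
    have e : (ζ - ζ ^ 3) * x * ((ζ - ζ ^ 3) * x) = 2 * (1 + (ζ - ζ ^ 3)) := by
      rw [hx, ← hw2]; ring
    rw [e]
    linear_combination heps
  · rintro ⟨x, hx⟩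
    have hx0 : x ≠ 0 := by
      rintro rfl
      exact mul_ne_zero hz0 heps0 (by rw [hx]; ring)
    apply key1 (ζ - ζ ^ 3) ((1 + (ζ - ζ ^ 3) + ζ ^ 2) / ((ζ - ζ ^ 3) * x)) hw0
    · rw [map_sub, map_pow, hτ']; ring
    rw [div_mul_div_comm, eq_div_iff (mul_ne_zero (mul_ne_zero hw0 hx0) (mul_ne_zero hw0 hx0))]
    have e : (ζ - ζ ^ 3) * x * ((ζ - ζ ^ 3) * x) = 2 * (ζ * (1 + (ζ - ζ ^ 3))) := by
      rw [hx, ← hw2]; ring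
    rw [e]
    linear_combination heps - 2 * (1 + (ζ - ζ ^ 3)) * h4

theorem cancel_right_aux {Q : Type*} [Group Q] {a b : Q} (h : a * b = b) : a = 1 :=
  mul_eq_right.1 h

theorem cancel_left_aux {Q : Type*} [Group Q] {a b : Q} (h : a * b = a) : b = 1 :=
  mul_eq_left.1 h

/-- every unit of `ℚ(ζ₈)` is a norm. -/
theorem cyc8_unit_isNm (K : Type*) [Field K] [NumberField K] [hK : IsCyclotomicExtension {8} ℚ K]
    (d : ℕ) (hd2 : 2 < d) (hd : Squarefree d) (hp : ∀ p ∈ d.primeFactors, p % 8 = 7)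
    (u : (𝓞 K)ˣ) : IsNm (d : K) ((u : 𝓞 K) : K) := by
  obtain ⟨ζ, hζ⟩ : ∃ ζ : K, ζ = IsCyclotomicExtension.zeta 8 ℚ K := ⟨_, rfl⟩
  obtain ⟨n1, n2, n3⟩ := cyc8_nonsq K ζ hζ
  have hpr : IsPrimitiveRoot ζ 8 := hζ ▸ IsCyclotomicExtension.zeta_spec 8 ℚ K
  have h4 : ζ ^ 4 = -1 := by
    have h8 := hpr.pow_eq_one
    have : (ζ ^ 4 - 1) * (ζ ^ 4 + 1) = 0 := by linear_combination h8
    rcases mul_eq_zero.1 this with h | h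
    · exact absurd (sub_eq_zero.1 h) (hpr.pow_ne_one_of_pos_of_lt (by norm_num) (by norm_num))
    · linear_combination h
  obtain ⟨m1, m2⟩ := isNm_zeta ζ h4 d hd hp (cyc8_d_notSquare K d hd2 hd hp)
  let z : 𝓞 K := hpr.toInteger
  have hz : (z : K) = ζ := rfl
  have hz4 : z ^ 4 = -1 := by apply RingOfIntegers.ext; simpa [hz] using h4
  let uz : (𝓞 K)ˣ := ⟨z, -z ^ 3, by linear_combination -hz4, by linear_combination -hz4⟩
  let ue : (𝓞 K)ˣ := ⟨1 + (z - z ^ 3), (z - z ^ 3) - 1,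
    by linear_combination (-2 + z ^ 2) * hz4, by linear_combination (-2 + z ^ 2) * hz4⟩
  have huz : ((uz : 𝓞 K) : K) = ζ := rfl
  have hue : ((ue : 𝓞 K) : K) = 1 + (ζ - ζ ^ 3) := by simp [ue, hz]
  have hcard : Nat.card {x : (𝓞 K)ˣ // x ^ 2 = 1} = 2 := by
    rw [Nat.card_eq_two_iff]
    refine ⟨⟨1, by simp⟩, ⟨-1, by simp⟩, ?_, ?_⟩
    · intro h
      have h1 : (1 : (𝓞 K)ˣ) = -1 := congrArg Subtype.val h
      have h2 : (1 : 𝓞 K) = -1 := by simpa using congrArg Units.val h1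
      have : (2 : 𝓞 K) = 0 := by linear_combination h2
      exact two_ne_zero this
    · ext ⟨x, hx⟩
      simp only [Set.mem_insert_iff, Set.mem_singleton_iff, Set.mem_univ, iff_true, Subtype.mk.injEq]
      have h1 : (x : 𝓞 K) ^ 2 = 1 := by rw [← Units.val_pow_eq_pow_val, hx]; rfl
      rcases (mul_self_eq_one_iff.1 ((sq _).symm.trans h1)) with h | h
      · left; ext; simp [h]
      · right; ext; simp [h]
  have hidx := sq_index_aux (𝓞 K)ˣ hcard
  rw [cyc8_rank K] at hidx
  obtain ⟨R, hRdef⟩ : ∃ R, R = (powMonoidHom (α := (𝓞 K)ˣ) 2).range := ⟨_, rfl⟩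
  rw [← hRdef] at hidx
  have hR : ∀ x : (𝓞 K)ˣ, x ∈ R → IsSquare ((x : 𝓞 K) : K) := by
    intro x hx
    rw [hRdef] at hx
    obtain ⟨y, rfl⟩ := hx
    exact ⟨((y : 𝓞 K) : K), by simp [sq]⟩
  let f : Bool × Bool → (𝓞 K)ˣ ⧸ R := fun b =>
    (((if b.1 then uz else 1) * (if b.2 then ue else 1) : (𝓞 K)ˣ) : (𝓞 K)ˣ ⧸ R)
  have hinv : ∀ g : (𝓞 K)ˣ, (g : (𝓞 K)ˣ ⧸ R)⁻¹ = g := by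
    intro g
    rw [inv_eq_iff_mul_eq_one, ← QuotientGroup.mk_mul, QuotientGroup.eq_one_iff, hRdef]
    exact ⟨g, by simp [sq]⟩
  have r1 : (uz : (𝓞 K)ˣ ⧸ R) ≠ 1 := by
    rw [Ne, QuotientGroup.eq_one_iff]; intro h; exact n1 (huz ▸ hR _ h)
  have r2 : (ue : (𝓞 K)ˣ ⧸ R) ≠ 1 := by
    rw [Ne, QuotientGroup.eq_one_iff]; intro h; exact n2 (hue ▸ hR _ h)
  have r3 : ((uz * ue : (𝓞 K)ˣ) : (𝓞 K)ˣ ⧸ R) ≠ 1 := by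
    rw [Ne, QuotientGroup.eq_one_iff]; intro h; apply n3; rw [← hue, ← huz]; simpa using hR _ h
  have r4 : (uz : (𝓞 K)ˣ ⧸ R) ≠ ue := by
    intro h; apply r3
    rw [QuotientGroup.mk_mul, ← h, ← inv_eq_iff_mul_eq_one, hinv]
  have hf : Function.Injective f := by
    rintro ⟨a, b⟩ ⟨a', b'⟩ h
    rw [QuotientGroup.mk_mul] at r3
    rcases a <;> rcases b <;> rcases a' <;> rcases b' <;>
      simp [f, r1, r2, r3, r4, r1.symm, r2.symm, r3.symm, r4.symm] at h ⊢
    · exact r1 (cancel_right_aux h.symm)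
    · exact r2 (cancel_left_aux h.symm)
    · exact r1 (cancel_right_aux h)
    · exact r2 (cancel_left_aux h)
  have hc : Nat.card ((𝓞 K)ˣ ⧸ R) = 4 := by simpa [Subgroup.index] using hidx
  have : Finite ((𝓞 K)ˣ ⧸ R) := Nat.finite_of_card_ne_zero (by omega)
  have hbij := hf.bijective_of_nat_card_le (by rw [hc]; simp)
  obtain ⟨⟨a, b⟩, hab⟩ := hbij.2 (u : (𝓞 K)ˣ ⧸ R)
  have hab' := QuotientGroup.eq.1 hab
  rw [hRdef] at hab'
  obtain ⟨v, hv⟩ := hab'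
  have hu : u = (if a then uz else 1) * (if b then ue else 1) * v ^ 2 := by
    simp only [powMonoidHom_apply] at hv
    rw [hv]; simp
  rw [hu]
  have h1 : IsNm (d : K) 1 := by simpa using IsNm.sq (d : K) 1
  simp only [Units.val_mul, map_mul, Units.val_pow_eq_pow_val, map_pow]
  refine (IsNm.mul ?_ ?_).mul (IsNm.sq _ _)
  · cases a
    · simpa using h1
    · simpa [huz] using m1
  · cases b
    · simpa using h1
    · simpa [hue] using m2
end PartM2

section PartE1
theorem comb_h90 {X : Type*} (ρ : X ≃ X) (hρ : ∀ x, ρ (ρ x) = x) (x : X →₀ ℤ)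
    (hx : x + Finsupp.domCongr ρ x = 0) :
    ∃ y : X →₀ ℤ, x = y - Finsupp.domCongr ρ y := by
  refine ⟨x.mapRange (fun n => max n 0) (by simp), ?_⟩
  ext a
  have h := DFunLike.congr_fun hx a
  simp only [Finsupp.domCongr_apply, Finsupp.add_apply, Finsupp.equivMapDomain_apply,
    Finsupp.sub_apply, Finsupp.mapRange_apply, Finsupp.zero_apply] at h ⊢
  omega

section comb
variable {X : Type*} (ρ : X ≃ X) (hρ : ∀ x, ρ (ρ x) = x) (T : Set X) (hT : ∀ x ∈ T, ρ x = x)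
    (N : AddSubgroup (X →₀ ℤ))
    (h1 : ∀ x, ρ x ≠ x → Finsupp.single x 1 + Finsupp.single (ρ x) 1 ∈ N)
    (h2 : ∀ x, ρ x = x → x ∉ T → Finsupp.single x 1 ∈ N)
    (h3 : ∀ x ∈ T, Finsupp.single x 2 ∈ N)

include hT h1 h2 h3 in
theorem comb_norm (J : X →₀ ℤ) : J + Finsupp.domCongr ρ J ∈ N := by
  induction J using Finsupp.induction_linear with
  | zero => simp
  | add f g hf hg =>
    have := N.add_mem hf hg
    rw [map_add]
    convert this using 1; abel
  | single x n =>
    have e : Finsupp.single x n + Finsupp.domCongr ρ (Finsupp.single x n)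
      = n • (Finsupp.single x (1:ℤ) + Finsupp.single (ρ x) (1:ℤ)) := by
      simp [Finsupp.domCongr_apply]
    rw [e]
    apply N.zsmul_mem
    by_cases hx : ρ x = x
    · rw [hx, ← Finsupp.single_add]
      by_cases hxT : x ∈ T
      · exact h3 x hxT
      · rw [Finsupp.single_add]
        exact N.add_mem (h2 x hx hxT) (h2 x hx hxT)
    · exact h1 x hx

include hρ hT h1 h2 h3 in
theorem comb_mem (n : ℕ) : ∀ J : X →₀ ℤ, J.support.card ≤ n → Finsupp.domCongr ρ J = J →
    (∀ x ∈ T, Even (J x)) → J ∈ N := by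
  classical
  have hs : ∀ x, ρ.symm x = ρ x := fun x => by rw [Equiv.symm_apply_eq, hρ]
  induction n with
  | zero =>
    intro J hJ _ _
    have : J = 0 := by simpa using hJ
    rw [this]; exact N.zero_mem
  | succ n ih =>
    intro J hJ hfix hev
    by_cases h0 : J = 0
    · rw [h0]; exact N.zero_mem
    obtain ⟨x, hx⟩ := Finsupp.ne_iff.1 h0
    have hx : J x ≠ 0 := by simpa using hx
    have hJρ : ∀ y, J (ρ y) = J y := by
      intro y
      have := DFunLike.congr_fun hfix y
      rwa [Finsupp.domCongr_apply, Finsupp.equivMapDomain_apply, hs] at this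
    -- remove the orbit of x
    obtain ⟨G, hG, hGx, hGs, hGfix, hGo⟩ : ∃ G ∈ N, G x = J x ∧ (∀ y, J y = 0 → G y = 0) ∧
        Finsupp.domCongr ρ G = G ∧ (∀ y ∈ T, Even (G y)) := by
      by_cases hxx : ρ x = x
      · have hmem : Finsupp.single x (J x) ∈ N := by
          by_cases hxT : x ∈ T
          · obtain ⟨k, hk⟩ := hev x hxT
            have := N.zsmul_mem (h3 x hxT) k
            rw [Finsupp.smul_single] at this
            rw [hk]; convert this using 2; simp; ring
          · have := N.zsmul_mem (h2 x hxx hxT) (J x)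
            rwa [Finsupp.smul_single, smul_eq_mul, mul_one] at this
        refine ⟨_, hmem, by simp, ?_, ?_, ?_⟩
        · intro y hy
          rw [Finsupp.single_apply]
          split_ifs with h
          · subst h; exact hy
          · rfl
        · simp [Finsupp.domCongr_apply, hxx]
        · intro y hy
          rw [Finsupp.single_apply]
          split_ifs with h
          · subst h; exact hev _ hy
          · simp
      · refine ⟨_, N.zsmul_mem (h1 x hxx) (J x), ?_, ?_, ?_, ?_⟩
        · simp [Finsupp.single_apply, hxx]
        · intro y hy
          have a1 : x ≠ y := by rintro rfl; exact hx hy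
          have a2 : ρ x ≠ y := by rintro rfl; rw [hJρ] at hy; exact hx hy
          simp [Finsupp.single_apply, a1, a2]
        · rw [map_zsmul, map_add]
          simp [Finsupp.domCongr_apply, hρ, add_comm]
        · intro y hy
          have a1 : x ≠ y := by rintro rfl; exact hxx (hT _ hy)
          have a2 : ρ x ≠ y := by
            rintro rfl; have := hT _ hy; rw [hρ] at this; exact hxx this.symm
          simp [Finsupp.single_apply, a1, a2]
    have := ih (J - G) ?_ (by rw [map_sub, hfix, hGfix]) ?_
    · have := N.add_mem this hG
      rwa [sub_add_cancel] at this
    · have hlt : (J - G).support.card < J.support.card := by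
        apply Finset.card_lt_card
        refine ⟨?_, ?_⟩
        · intro y hy
          rw [Finsupp.mem_support_iff] at hy ⊢
          intro h
          apply hy; rw [Finsupp.sub_apply, h, hGs y h, sub_zero]
        · intro hsub
          have := hsub (Finsupp.mem_support_iff.2 hx)
          rw [Finsupp.mem_support_iff] at this
          exact this (by rw [Finsupp.sub_apply, hGx, sub_self])
      omega
    · intro y hy
      rw [Finsupp.sub_apply]
      exact (hev y hy).sub (hGo y hy)

include hρ hT h1 h2 h3 in
theorem comb_index [Finite T] (F : AddSubgroup (X →₀ ℤ))
    (hF : ∀ J, J ∈ F ↔ Finsupp.domCongr ρ J = J)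
    (hNF : N ≤ F) (hNT : ∀ J ∈ N, ∀ x ∈ T, Even (J x)) :
    N.relIndex F = 2 ^ Nat.card T := by
  classical
  let φ : (X →₀ ℤ) →+ (T → ZMod 2) :=
    { toFun := fun J x => (J x : ZMod 2)
      map_zero' := by ext; simp
      map_add' := by intros; ext; simp }
  have hφ : ∀ J (x : T), φ J x = (J x : ZMod 2) := fun _ _ => rfl
  have hker : (φ.comp F.subtype).ker = N.addSubgroupOf F := by
    ext ⟨J, hJ⟩
    rw [AddMonoidHom.mem_ker, AddSubgroup.mem_addSubgroupOf]
    constructor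
    · intro h
      refine comb_mem ρ hρ T hT N h1 h2 h3 _ J le_rfl ((hF J).1 hJ) ?_
      intro x hx
      have := congrFun h ⟨x, hx⟩
      rw [even_iff_two_dvd]
      exact (ZMod.intCast_zmod_eq_zero_iff_dvd (J x) 2).1 this
    · intro h
      ext x
      exact (ZMod.intCast_zmod_eq_zero_iff_dvd (J x) 2).2 (even_iff_two_dvd.1 (hNT J h x x.2))
  have hsurj : Function.Surjective (φ.comp F.subtype) := by
    intro g
    haveI := Fintype.ofFinite T
    refine ⟨⟨∑ x : T, Finsupp.single (x : X) ((g x).val : ℤ), ?_⟩, ?_⟩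
    · refine F.sum_mem fun x _ => ?_
      rw [hF]; simp [Finsupp.domCongr_apply, hT x x.2]
    · ext y
      simp only [AddMonoidHom.comp_apply, AddSubgroup.subtype_apply, hφ, Finsupp.finsetSum_apply,
        Finsupp.single_apply]
      rw [Finset.sum_eq_single y]
      · simp
      · intro b _ hb
        rw [if_neg (fun h => hb (Subtype.ext h))]
      · simp
  rw [AddSubgroup.relIndex, ← hker, AddSubgroup.index_ker, AddMonoidHom.range_eq_top.2 hsurj]
  rw [Nat.card_congr AddSubgroup.topEquiv.toEquiv, Nat.card_fun]
  simp
end comb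
end PartE1

section PartE2
open NumberField nonZeroDivisors IsDedekindDomain

section divisor
variable (R F : Type*) [CommRing R] [IsDedekindDomain R] [Field F] [Algebra R F]
  [IsFractionRing R F]

/-- The divisor of a fractional ideal. -/
noncomputable def idealDiv : (FractionalIdeal R⁰ F)ˣ →* Multiplicative (HeightOneSpectrum R →₀ ℤ) where
  toFun J := Multiplicative.ofAdd (Finsupp.ofSupportFinite
    (fun v => FractionalIdeal.count F v (J : FractionalIdeal R⁰ F)) (by
      have := FractionalIdeal.finite_factors (K := F) (J : FractionalIdeal R⁰ F)
      rw [Filter.eventually_cofinite] at this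
      exact this))
  map_one' := by
    apply Multiplicative.toAdd.injective
    ext v
    simp [Finsupp.ofSupportFinite_coe, FractionalIdeal.count_one]
  map_mul' I J := by
    apply Multiplicative.toAdd.injective
    ext v
    exact FractionalIdeal.count_mul F v I.ne_zero J.ne_zero

theorem idealDiv_apply (J : (FractionalIdeal R⁰ F)ˣ) (v : HeightOneSpectrum R) :
    (Multiplicative.toAdd (idealDiv R F J)) v = FractionalIdeal.count F v (J : FractionalIdeal R⁰ F) :=
  rfl

theorem idealDiv_bij : Function.Bijective (idealDiv R F) := by
  constructor
  · intro I J h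
    ext1
    rw [← FractionalIdeal.finprod_heightOneSpectrum_factorization' F I.ne_zero,
      ← FractionalIdeal.finprod_heightOneSpectrum_factorization' F J.ne_zero]
    refine finprod_congr fun v => ?_
    rw [← idealDiv_apply, h, idealDiv_apply]
  · intro f
    refine ⟨Units.mk0 ((Multiplicative.toAdd f).prod
      (fun v n => ((v.asIdeal : Ideal R) : FractionalIdeal R⁰ F) ^ n)) ?_, ?_⟩
    · rw [Finsupp.prod, Finset.prod_ne_zero_iff]
      exact fun v hv ↦ zpow_ne_zero _ (FractionalIdeal.coeIdeal_ne_zero.mpr v.ne_bot)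
    · apply Multiplicative.toAdd.injective
      ext v
      rw [idealDiv_apply]
      exact FractionalIdeal.count_finsuppProd F v _

/-- The divisor of a nonzero element of the fraction field. -/
noncomputable def eltDiv : Fˣ →* Multiplicative (HeightOneSpectrum R →₀ ℤ) :=
  (idealDiv R F).comp (toPrincipalIdeal R F)

theorem eltDiv_apply (x : Fˣ) (v : HeightOneSpectrum R) :
    (Multiplicative.toAdd (eltDiv R F x)) v =
      FractionalIdeal.count F v (FractionalIdeal.spanSingleton R⁰ (x : F)) := by
  rw [eltDiv, MonoidHom.comp_apply, idealDiv_apply, coe_toPrincipalIdeal]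

theorem card_classGroup_two :
    Nat.card {c : ClassGroup R // c ^ 2 = 1} =
    Nat.card {c : Multiplicative (HeightOneSpectrum R →₀ ℤ) ⧸ (eltDiv R F).range // c ^ 2 = 1} := by
  let E := MulEquiv.ofBijective _ (idealDiv_bij R F)
  let e : ClassGroup R ≃* Multiplicative (HeightOneSpectrum R →₀ ℤ) ⧸ (eltDiv R F).range :=
    (ClassGroup.equiv F).trans (QuotientGroup.congr _ _ E (by
      rw [eltDiv, MonoidHom.range_comp]; rfl))
  refine Nat.card_congr (e.toEquiv.subtypeEquiv ?_)
  intro c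
  constructor
  · intro h; simp [← map_pow, h]
  · intro h
    apply e.injective
    rw [map_pow, map_one]; exact h

theorem eltDiv_ker (x : Fˣ) : eltDiv R F x = 1 ↔ ∃ u : Rˣ, algebraMap R F u = x := by
  rw [eltDiv, MonoidHom.comp_apply, ← (idealDiv R F).map_one, (idealDiv_bij R F).1.eq_iff]
  constructor
  · intro h
    have h1 : FractionalIdeal.spanSingleton R⁰ (x : F) = 1 := by
      have := congrArg Units.val h
      simpa using this
    have h2 : FractionalIdeal.spanSingleton R⁰ ((x⁻¹ : Fˣ) : F) = 1 := by
      have := congrArg Units.val (show toPrincipalIdeal R F x⁻¹ = 1 by rw [map_inv, h, inv_one])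
      simpa using this
    have m1 : (x : F) ∈ (1 : FractionalIdeal R⁰ F) := h1 ▸ FractionalIdeal.mem_spanSingleton_self _ _
    have m2 : ((x⁻¹ : Fˣ) : F) ∈ (1 : FractionalIdeal R⁰ F) :=
      h2 ▸ FractionalIdeal.mem_spanSingleton_self _ _
    obtain ⟨a, ha⟩ := (FractionalIdeal.mem_one_iff _).1 m1
    obtain ⟨b, hb⟩ := (FractionalIdeal.mem_one_iff _).1 m2
    have hab : a * b = 1 := by
      apply IsFractionRing.injective R F
      rw [map_mul, ha, hb, map_one]; simp
    exact ⟨⟨a, b, hab, by rw [mul_comm, hab]⟩, ha⟩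
  · rintro ⟨u, hu⟩
    ext1
    rw [coe_toPrincipalIdeal, ← hu, ← FractionalIdeal.coeIdeal_span_singleton]
    rw [Ideal.span_singleton_eq_top.2 u.isUnit]; simp

theorem eltDiv_algebraMap (x : R) (y : Fˣ) (hy : algebraMap R F x = y) (v : HeightOneSpectrum R) :
    (Multiplicative.toAdd (eltDiv R F y)) v = multiplicity v.asIdeal (Ideal.span {x}) := by
  classical
  have hx : x ≠ 0 := by rintro rfl; exact y.ne_zero (by rw [← hy, map_zero])
  have hx' : Ideal.span {x} ≠ 0 := by simpa using hx
  rw [eltDiv_apply, ← hy, ← FractionalIdeal.coeIdeal_span_singleton, FractionalIdeal.count_coe F v hx']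
  rw [Ideal.count_associates_factors_eq hx' v.isPrime v.ne_bot,
    HeightOneSpectrum.count_normalizedFactors_eq_multiplicity hx']
end divisor
end PartE2

section PartE3
open NumberField nonZeroDivisors IsDedekindDomain
open scoped Pointwise

section equivariant
variable {G : Type*} [Group G] {R F : Type*} [CommRing R] [IsDedekindDomain R] [Field F]
  [Algebra R F] [IsFractionRing R F] [MulSemiringAction G R] [MulSemiringAction G F]
  [SMulDistribClass G R F]

/-- The action of a ring automorphism on primes. -/
def primeSmul (g : G) : HeightOneSpectrum R ≃ HeightOneSpectrum R where
  toFun v := ⟨g • v.asIdeal, (Ideal.IsPrime.smul_iff g).2 v.isPrime, fun h => v.ne_bot (by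
    have := congrArg (g⁻¹ • ·) h
    simpa using this)⟩
  invFun v := ⟨g⁻¹ • v.asIdeal, (Ideal.IsPrime.smul_iff g⁻¹).2 v.isPrime, fun h => v.ne_bot (by
    have := congrArg (g • ·) h
    simpa using this)⟩
  left_inv v := by ext1; simp
  right_inv v := by ext1; simp

omit [IsDedekindDomain R] in
theorem primeSmul_asIdeal (g : G) (v : HeightOneSpectrum R) :
    (primeSmul g v).asIdeal = g • v.asIdeal := rfl

theorem eltDiv_smul_int (g : G) (x : R) (y y' : Fˣ) (hy : algebraMap R F x = y)
    (hyy : (y' : F) = g • (y : F)) (v : HeightOneSpectrum R) :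
    (Multiplicative.toAdd (eltDiv R F y')) (primeSmul g v) =
      (Multiplicative.toAdd (eltDiv R F y)) v := by
  have h1 : algebraMap R F (g • x) = y' := by rw [hyy, ← hy, algebraMap.smul']
  rw [eltDiv_algebraMap R F x y hy, eltDiv_algebraMap R F (g • x) y' h1, primeSmul_asIdeal]
  have h2 : Ideal.span {g • x} = g • Ideal.span {x} := by
    rw [Ideal.smul_closure]; simp
  rw [h2]
  exact_mod_cast multiplicity_map_eq (MulDistribMulAction.toMulEquiv (Ideal R) g)

theorem eltDiv_smul (g : G) (y y' : Fˣ)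
    (hyy : (y' : F) = g • (y : F)) :
    (Multiplicative.toAdd (eltDiv R F y')) =
      Finsupp.domCongr (primeSmul g) (Multiplicative.toAdd (eltDiv R F y)) := by
  ext w
  obtain ⟨v, rfl⟩ := (primeSmul g).surjective w
  rw [Finsupp.domCongr_apply, Finsupp.equivMapDomain_apply, Equiv.symm_apply_apply]
  obtain ⟨a, b, hb, hab⟩ := IsFractionRing.div_surjective (A := R) (y : F)
  have hb0 : algebraMap R F b ≠ 0 := IsFractionRing.to_map_ne_zero_of_mem_nonZeroDivisors hb
  have ha0 : algebraMap R F a ≠ 0 := by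
    intro h; rw [h, zero_div] at hab; exact y.ne_zero hab.symm
  let ua := Units.mk0 _ ha0
  let ub := Units.mk0 _ hb0
  let s := Units.map (MulDistribMulAction.toMonoidHom F g)
  have hs : ∀ z : Fˣ, ((s z : Fˣ) : F) = g • (z : F) := fun z => rfl
  have hy : y = ua / ub := by ext; simp [ua, ub, hab]
  have hy' : y' = s ua / s ub := by
    rw [← map_div, ← hy]; ext; rw [hyy, hs]
  rw [hy, hy', map_div (eltDiv R F), map_div (eltDiv R F), toAdd_div, toAdd_div, Finsupp.sub_apply, Finsupp.sub_apply,
    eltDiv_smul_int g a ua (s ua) rfl (hs _), eltDiv_smul_int g b ub (s ub) rfl (hs _)]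

end equivariant

theorem eltDiv_eq_of_mul {R F : Type*} [CommRing R] [IsDedekindDomain R] [Field F]
    [Algebra R F] [IsFractionRing R F] (x : R) (y : Fˣ) (hy : algebraMap R F x = y)
    (v w : HeightOneSpectrum R) (h : Ideal.span {x} = v.asIdeal * w.asIdeal) :
    Multiplicative.toAdd (eltDiv R F y) = Finsupp.single v 1 + Finsupp.single w 1 := by
  classical
  ext u
  rw [eltDiv_apply, ← hy, ← FractionalIdeal.coeIdeal_span_singleton, h,
    FractionalIdeal.coeIdeal_mul, FractionalIdeal.count_mul _ _
      (FractionalIdeal.coeIdeal_ne_zero.mpr v.ne_bot) (FractionalIdeal.coeIdeal_ne_zero.mpr w.ne_bot),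
    FractionalIdeal.count_maximal, FractionalIdeal.count_maximal]
  simp [Finsupp.single_apply]

theorem eltDiv_eq_of_prime {R F : Type*} [CommRing R] [IsDedekindDomain R] [Field F]
    [Algebra R F] [IsFractionRing R F] (x : R) (y : Fˣ) (hy : algebraMap R F x = y)
    (v : HeightOneSpectrum R) (h : Ideal.span {x} = v.asIdeal) :
    Multiplicative.toAdd (eltDiv R F y) = Finsupp.single v 1 := by
  classical
  ext u
  rw [eltDiv_apply, ← hy, ← FractionalIdeal.coeIdeal_span_singleton, h,
    FractionalIdeal.count_maximal]
  simp [Finsupp.single_apply]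

theorem eltDiv_eq_zero_of_notMem {R F : Type*} [CommRing R] [IsDedekindDomain R] [Field F]
    [Algebra R F] [IsFractionRing R F] (x : R) (y : Fˣ) (hy : algebraMap R F x = y)
    (v : HeightOneSpectrum R) (h : x ∉ v.asIdeal) :
    (Multiplicative.toAdd (eltDiv R F y)) v = 0 := by
  rw [eltDiv_algebraMap R F x y hy]
  have : ¬ v.asIdeal ∣ Ideal.span {x} := by
    rw [Ideal.dvd_span_singleton]; exact h
  exact_mod_cast multiplicity_eq_zero.2 this
end PartE3

section PartE4
open NumberField nonZeroDivisors IsDedekindDomain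
open scoped Pointwise

section primes
variable {K L : Type*} [Field K] [Field L] [NumberField K] [NumberField L] [Algebra K L]
  [IsGalois K L] (σ : Gal(L/K)) (hσ : ∀ g : Gal(L/K), g = 1 ∨ g = σ) (hσ1 : σ ≠ 1)

include hσ hσ1

omit [NumberField K] [NumberField L] [IsGalois K L] in
theorem card_gal_two : Nat.card Gal(L/K) = 2 := by
  classical
  rw [Nat.card_eq_two_iff]
  refine ⟨1, σ, hσ1.symm, ?_⟩
  ext g; simpa using hσ g

omit [NumberField K] [NumberField L] [IsGalois K L] in
theorem gal_two_sq : σ * σ = 1 := by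
  rcases hσ (σ * σ) with h | h
  · exact h
  · exact absurd (mul_eq_left.1 h) hσ1

theorem prime_factor (v : HeightOneSpectrum (𝓞 L)) :
    (σ • v.asIdeal ≠ v.asIdeal ∧
      (v.asIdeal.under (𝓞 K)).map (algebraMap (𝓞 K) (𝓞 L)) = v.asIdeal * σ • v.asIdeal) ∨
    (σ • v.asIdeal = v.asIdeal ∧ (¬ ∀ x : 𝓞 L, σ • x - x ∈ v.asIdeal) ∧
      (v.asIdeal.under (𝓞 K)).map (algebraMap (𝓞 K) (𝓞 L)) = v.asIdeal) ∨
    (σ • v.asIdeal = v.asIdeal ∧ (∀ x : 𝓞 L, σ • x - x ∈ v.asIdeal) ∧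
      (v.asIdeal.under (𝓞 K)).map (algebraMap (𝓞 K) (𝓞 L)) = v.asIdeal ^ 2) := by
  classical
  have : v.asIdeal.IsPrime := v.isPrime
  set P := v.asIdeal with hP
  have hPbot : P ≠ ⊥ := v.ne_bot
  set p := P.under (𝓞 K) with hp
  have hpbot : p ≠ ⊥ := mt Ideal.eq_bot_of_comap_eq_bot hPbot
  have : P.LiesOver p := ⟨rfl⟩
  have : p.IsPrime := Ideal.IsPrime.under _ _
  have : p.IsMaximal := Ideal.IsPrime.isMaximal this hpbot
  have hset : p.primesOver (𝓞 L) = {P, σ • P} := by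
    ext Q
    constructor
    · rintro ⟨h1, h2⟩
      obtain ⟨g, hg⟩ := Ideal.exists_smul_eq_of_isGaloisGroup p P Q Gal(L/K)
      rcases hσ g with rfl | rfl
      · left; rw [← hg, one_smul]
      · right; exact hg.symm
    · rintro (rfl | rfl)
      · exact ⟨inferInstance, inferInstance⟩
      · exact ⟨inferInstance, inferInstance⟩
  have hcard := card_gal_two σ hσ hσ1
  have hefg := Ideal.ncard_primesOver_mul_ramificationIdxIn_mul_inertiaDegIn p (𝓞 L) Gal(L/K)
  have hin := Ideal.card_inertia_eq_ramificationIdxIn (G := Gal(L/K)) p P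
  have he := Ideal.ramificationIdxIn_eq_ramificationIdx p P Gal(L/K)
  have he' := Ideal.ramificationIdxIn_eq_ramificationIdx p (σ • P) Gal(L/K)
  have hprod := Ideal.map_algebraMap_eq_finsetProd_pow (R := 𝓞 L) (p := p) hpbot
  have hinert : (σ ∈ P.inertia Gal(L/K)) ↔ ∀ x : 𝓞 L, σ • x - x ∈ P := Iff.rfl
  rw [hcard, hset] at hefg
  by_cases hfix : σ • P = P
  · right
    have hprod' : p.map (algebraMap (𝓞 K) (𝓞 L)) = P ^ (P.ramificationIdx (𝓞 K)) := by
      rw [hprod]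
      have : (p.primesOver (𝓞 L)).toFinset = {P} := by
        ext Q; simp [hset, hfix]
      rw [this, Finset.prod_singleton]
    by_cases hI : ∀ x : 𝓞 L, σ • x - x ∈ P
    · right
      refine ⟨hfix, hI, ?_⟩
      have htop : P.inertia Gal(L/K) = ⊤ := by
        rw [eq_top_iff]
        intro g _
        rcases hσ g with rfl | rfl
        · exact one_mem _
        · exact hinert.2 hI
      rw [htop, Subgroup.card_top, hcard] at hin
      rw [hprod', ← he, ← hin]
    · left
      refine ⟨hfix, hI, ?_⟩
      have hbot : P.inertia Gal(L/K) = ⊥ := by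
        rw [eq_bot_iff]
        intro g hg
        rcases hσ g with rfl | rfl
        · exact one_mem _
        · exact absurd (hinert.1 hg) hI
      rw [hbot, Subgroup.card_bot] at hin
      rw [hprod', ← he, ← hin, pow_one]
  · left
    refine ⟨hfix, ?_⟩
    have h2 : ({P, σ • P} : Set (Ideal (𝓞 L))).ncard = 2 := Set.ncard_pair (Ne.symm hfix)
    rw [h2] at hefg
    have h1 : p.ramificationIdxIn (𝓞 L) = 1 := by
      have : p.ramificationIdxIn (𝓞 L) * p.inertiaDegIn (𝓞 L) = 1 := by omega
      exact Nat.dvd_one.1 ⟨_, this.symm⟩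
    rw [hprod]
    have : (p.primesOver (𝓞 L)).toFinset = {P, σ • P} := by
      ext Q; simp [hset]
    rw [this, Finset.prod_pair (Ne.symm hfix), ← he, ← he', h1, pow_one, pow_one]
end primes
end PartE4

section PartE5
open NumberField nonZeroDivisors IsDedekindDomain
open scoped Pointwise

theorem mul_div_cancel_of_ne_aux {K : Type*} [Field K] (y : K) {x : K} (hx : x ≠ 0) :
    x * (y / x) = y := by field_simp

section primes2
variable {K L : Type*} [Field K] [Field L] [NumberField K] [NumberField L] [Algebra K L]
  [IsGalois K L] (σ : Gal(L/K)) (hσ : ∀ g : Gal(L/K), g = 1 ∨ g = σ) (hσ1 : σ ≠ 1)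
  [IsPrincipalIdealRing (𝓞 K)] (D : 𝓞 K) (S : 𝓞 L) (hS : S ^ 2 = algebraMap (𝓞 K) (𝓞 L) D)
  (hσS : σ • S = -S) (hnsq : ∀ p : Ideal (𝓞 K), p.IsPrime → D ∈ p → D ∉ p ^ 2)
  (hin : ∀ P : Ideal (𝓞 L), P.IsPrime → (∀ x : 𝓞 L, σ • x - x ∈ P) →
    algebraMap (𝓞 K) (𝓞 L) D ∈ P)

omit [NumberField K] [NumberField L] [IsGalois K L] [IsPrincipalIdealRing (𝓞 K)] in
theorem dvd_descend (x y : 𝓞 K) (hx : x ≠ 0) (z : 𝓞 L)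
    (h : algebraMap (𝓞 K) (𝓞 L) y = algebraMap (𝓞 K) (𝓞 L) x * z) : x ∣ y := by
  have h' : algebraMap K L (y : K) = algebraMap K L (x : K) * (z : L) := by
    have := congrArg (algebraMap (𝓞 L) L) h
    rw [map_mul] at this
    exact this
  have hx' : (x : K) ≠ 0 := by simpa using hx
  have hz : (z : L) = algebraMap K L ((y : K) / x) := by
    rw [map_div₀, h', mul_div_cancel_left₀]
    simpa using hx'
  have h_integral : IsIntegral ℤ ((y : K) / x) := by
    rw [← isIntegral_algebraMap_iff (algebraMap K L).injective (A := K), ← hz]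
    exact z.2
  refine ⟨⟨(y : K) / x, h_integral⟩, ?_⟩
  apply RingOfIntegers.ext
  exact (mul_div_cancel_of_ne_aux (y : K) hx').symm

include hσ hσ1 hS hσS hnsq in
theorem prime_ram (v : HeightOneSpectrum (𝓞 L)) (hv : algebraMap (𝓞 K) (𝓞 L) D ∈ v.asIdeal) :
    σ • v.asIdeal = v.asIdeal ∧
      (v.asIdeal.under (𝓞 K)).map (algebraMap (𝓞 K) (𝓞 L)) = v.asIdeal ^ 2 := by
  have hvp := v.isPrime
  have hSv : S ∈ v.asIdeal := by
    rw [← hS] at hv; exact hvp.mem_of_pow_mem _ hv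
  have hSv' : S ∈ σ • v.asIdeal := by
    have := Ideal.smul_mem_pointwise_smul σ S v.asIdeal hSv
    rw [hσS] at this
    simpa using this
  have hpbot : v.asIdeal.under (𝓞 K) ≠ ⊥ := mt Ideal.eq_bot_of_comap_eq_bot v.ne_bot
  have key : S ∉ (v.asIdeal.under (𝓞 K)).map (algebraMap (𝓞 K) (𝓞 L)) := by
    intro h
    obtain ⟨π, hπ⟩ := (IsPrincipalIdealRing.principal (v.asIdeal.under (𝓞 K))).principal
    have hπ : v.asIdeal.under (𝓞 K) = Ideal.span {π} := hπ
    have hπ0 : π ≠ 0 := by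
      rintro rfl; apply hpbot; rw [hπ]; simp
    rw [hπ, Ideal.map_span, Set.image_singleton, Ideal.mem_span_singleton] at h
    obtain ⟨y, hy⟩ := h
    have h2 : π ^ 2 ∣ D := by
      refine dvd_descend (L := L) (π ^ 2) D (pow_ne_zero _ hπ0) (y ^ 2) ?_
      rw [← hS, hy, map_pow, mul_pow]
    refine hnsq (v.asIdeal.under (𝓞 K)) (Ideal.IsPrime.under _ _) hv ?_
    rw [hπ, Ideal.span_singleton_pow, Ideal.mem_span_singleton]
    exact h2
  rcases prime_factor σ hσ hσ1 v with ⟨h1, h2⟩ | ⟨h1, _, h2⟩ | ⟨h1, _, h2⟩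
  · exfalso
    apply key
    rw [h2, Ideal.mul_eq_inf_of_isCoprime]
    · exact ⟨hSv, hSv'⟩
    · have m1 := v.isMaximal
      have m2 : (σ • v.asIdeal).IsMaximal := (primeSmul σ v).isMaximal
      exact Ideal.isCoprime_of_isMaximal (Ne.symm h1)
  · exfalso; apply key; rw [h2]; exact hSv
  · exact ⟨h1, h2⟩

include hσ hσ1 hS hσS hnsq hin in
theorem prime_div (v : HeightOneSpectrum (𝓞 L)) :
    ∃ a : Kˣ,
      (primeSmul σ v ≠ v → Multiplicative.toAdd (eltDiv (𝓞 L) L (Units.map (algebraMap K L) a))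
        = Finsupp.single v 1 + Finsupp.single (primeSmul σ v) 1) ∧
      (primeSmul σ v = v → algebraMap (𝓞 K) (𝓞 L) D ∉ v.asIdeal →
        Multiplicative.toAdd (eltDiv (𝓞 L) L (Units.map (algebraMap K L) a))
        = Finsupp.single v 1) ∧
      (algebraMap (𝓞 K) (𝓞 L) D ∈ v.asIdeal →
        Multiplicative.toAdd (eltDiv (𝓞 L) L (Units.map (algebraMap K L) a))
        = Finsupp.single v 2) := by
  have hpbot : v.asIdeal.under (𝓞 K) ≠ ⊥ := mt Ideal.eq_bot_of_comap_eq_bot v.ne_bot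
  obtain ⟨π, hπ⟩ := (IsPrincipalIdealRing.principal (v.asIdeal.under (𝓞 K))).principal
  have hπ : v.asIdeal.under (𝓞 K) = Ideal.span {π} := hπ
  have hπ0 : π ≠ 0 := by
    rintro rfl; apply hpbot; rw [hπ]; simp
  have hπ0' : (π : K) ≠ 0 := by simpa using hπ0
  have hmap : (v.asIdeal.under (𝓞 K)).map (algebraMap (𝓞 K) (𝓞 L)) =
    Ideal.span {algebraMap (𝓞 K) (𝓞 L) π} := by
    rw [hπ, Ideal.map_span, Set.image_singleton]
  have hmk : algebraMap (𝓞 L) L (algebraMap (𝓞 K) (𝓞 L) π) =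
      (Units.map (algebraMap K L) (Units.mk0 _ hπ0') : Lˣ) := rfl
  have hiff : primeSmul σ v = v ↔ σ • v.asIdeal = v.asIdeal := by
    rw [HeightOneSpectrum.ext_iff, primeSmul_asIdeal]
  refine ⟨Units.mk0 _ hπ0', ?_, ?_, ?_⟩
  · intro h
    rw [ne_eq, hiff] at h
    apply eltDiv_eq_of_mul _ _ hmk
    rw [← hmap, primeSmul_asIdeal]
    rcases prime_factor σ hσ hσ1 v with ⟨h1, h2⟩ | ⟨h1, _, h2⟩ | ⟨h1, _, h2⟩
    · exact h2
    · exact absurd h1 h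
    · exact absurd h1 h
  · intro h hD
    rw [hiff] at h
    apply eltDiv_eq_of_prime _ _ hmk
    rw [← hmap]
    rcases prime_factor σ hσ hσ1 v with ⟨h1, h2⟩ | ⟨h1, _, h2⟩ | ⟨h1, h3, h2⟩
    · exact absurd h h1
    · exact h2
    · exact absurd (hin _ v.isPrime h3) hD
  · intro hD
    rw [show (2 : ℤ) = 1 + 1 by norm_num, Finsupp.single_add]
    apply eltDiv_eq_of_mul _ _ hmk
    rw [← hmap, (prime_ram σ hσ hσ1 D S hS hσS hnsq v hD).2, sq]

include hσ hσ1 hS hσS hnsq in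
theorem even_div_int (v : HeightOneSpectrum (𝓞 L)) (hv : algebraMap (𝓞 K) (𝓞 L) D ∈ v.asIdeal)
    (a : 𝓞 K) : ∀ y : Lˣ, algebraMap (𝓞 L) L (algebraMap (𝓞 K) (𝓞 L) a) = y →
      Even ((Multiplicative.toAdd (eltDiv (𝓞 L) L y)) v) := by
  induction a using UniqueFactorizationMonoid.induction_on_prime with
  | h₁ => intro y hy; exact absurd hy.symm (by simp)
  | h₂ x hx =>
    intro y hy
    have : eltDiv (𝓞 L) L y = 1 := by
      rw [eltDiv_ker]
      exact ⟨(hx.map (algebraMap (𝓞 K) (𝓞 L))).unit, hy⟩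
    rw [this]; simp
  | h₃ a q ha hq ih =>
    intro y hy
    have hq0 : algebraMap (𝓞 L) L (algebraMap (𝓞 K) (𝓞 L) q) ≠ 0 := by
      intro h; rw [map_mul, map_mul, h, zero_mul] at hy; exact y.ne_zero hy.symm
    have ha0 : algebraMap (𝓞 L) L (algebraMap (𝓞 K) (𝓞 L) a) ≠ 0 := by
      intro h; rw [map_mul, map_mul, h, mul_zero] at hy; exact y.ne_zero hy.symm
    have hyy : y = Units.mk0 _ hq0 * Units.mk0 _ ha0 := by
      ext; simp [← hy]
    rw [hyy, map_mul (eltDiv (𝓞 L) L), toAdd_mul, Finsupp.add_apply]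
    refine Even.add ?_ (ih _ rfl)
    by_cases hqv : algebraMap (𝓞 K) (𝓞 L) q ∈ v.asIdeal
    · have hle : Ideal.span {q} ≤ v.asIdeal.under (𝓞 K) := by
        rw [Ideal.span_singleton_le_iff_mem]; exact hqv
      have hpr : (Ideal.span {q}).IsPrime := (Ideal.span_singleton_prime hq.ne_zero).2 hq
      have hmax : (Ideal.span {q}).IsMaximal := hpr.isMaximal (by simpa using hq.ne_zero)
      have hvp := v.isPrime
      have heq := hmax.eq_of_le (Ideal.IsPrime.ne_top (Ideal.IsPrime.under (𝓞 K) v.asIdeal)) hle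
      have h2 := (prime_ram σ hσ hσ1 D S hS hσS hnsq v hv).2
      rw [← heq, Ideal.map_span, Set.image_singleton, sq] at h2
      rw [eltDiv_eq_of_mul _ (Units.mk0 _ hq0) rfl v v h2]
      exact ⟨1, by simp⟩
    · rw [eltDiv_eq_zero_of_notMem _ (Units.mk0 _ hq0) rfl v hqv]; simp

include hσ hσ1 hS hσS hnsq in
theorem even_div (v : HeightOneSpectrum (𝓞 L)) (hv : algebraMap (𝓞 K) (𝓞 L) D ∈ v.asIdeal)
    (a : Kˣ) :
      Even ((Multiplicative.toAdd (eltDiv (𝓞 L) L (Units.map (algebraMap K L) a))) v) := by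
  obtain ⟨x, y, hy, hxy⟩ := IsFractionRing.div_surjective (A := 𝓞 K) (a : K)
  have hb0 : algebraMap (𝓞 K) K y ≠ 0 := IsFractionRing.to_map_ne_zero_of_mem_nonZeroDivisors hy
  have ha0 : algebraMap (𝓞 K) K x ≠ 0 := by
    intro h; rw [h, zero_div] at hxy; exact a.ne_zero hxy.symm
  have ha : a = Units.mk0 _ ha0 / Units.mk0 _ hb0 := by ext; simp [hxy]
  rw [ha, map_div (Units.map ((algebraMap K L : K →* L))), map_div (eltDiv (𝓞 L) L), toAdd_div, Finsupp.sub_apply]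
  exact (even_div_int σ hσ hσ1 D S hS hσS hnsq v hv x _ rfl).sub
    (even_div_int σ hσ hσ1 D S hS hσS hnsq v hv y _ rfl)
end primes2
end PartE5

section PartE6
open NumberField nonZeroDivisors IsDedekindDomain
open scoped Pointwise

theorem card_TK (K : Type*) [Field K] [NumberField K] (d : ℕ) (hd : Squarefree d)
    (h2 : ∀ q ∈ d.primeFactors, (Ideal.primesOver (Ideal.span {(q:ℤ)}) (𝓞 K)).ncard = 2) :
    Nat.card {p : Ideal (𝓞 K) // p.IsPrime ∧ (d : 𝓞 K) ∈ p} = 2 * d.primeFactors.card := by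
  have hprod : ∏ q ∈ d.primeFactors, q = d := Nat.prod_primeFactors_of_squarefree hd
  let f : (Σ q : d.primeFactors, Ideal.primesOver (Ideal.span {((q : ℕ) : ℤ)}) (𝓞 K)) →
      {p : Ideal (𝓞 K) // p.IsPrime ∧ (d : 𝓞 K) ∈ p} := fun x => ⟨x.2.1, x.2.2.1, by
    have h1 := x.2.2.2
    have h3 : ((x.1 : ℕ) : ℤ) ∈ Ideal.span {((x.1 : ℕ) : ℤ)} := Ideal.mem_span_singleton_self _
    rw [(Ideal.liesOver_iff _ _).1 h1, Ideal.under_def, Ideal.mem_comap] at h3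
    obtain ⟨k, hk⟩ := Nat.dvd_of_mem_primeFactors x.1.2
    have hk' : (d : 𝓞 K) = ((x.1 : ℕ) : 𝓞 K) * (k : 𝓞 K) := by exact_mod_cast congrArg (Nat.cast (R := 𝓞 K)) hk
    rw [hk']
    apply Ideal.mul_mem_right
    simpa using h3⟩
  have hf : Function.Bijective f := by
    constructor
    · rintro ⟨q, P, hP⟩ ⟨q', P', hP'⟩ h
      have hPP : P = P' := congrArg Subtype.val h
      subst hPP
      have h1 := (Ideal.liesOver_iff _ _).1 hP.2
      have h2 := (Ideal.liesOver_iff _ _).1 hP'.2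
      have : q = q' := by
        rw [← h2, Ideal.span_singleton_eq_span_singleton, Int.associated_iff_natAbs] at h1
        ext; simpa using h1
      subst this
      rfl
    · rintro ⟨p, hp, hdp⟩
      have : ∃ q ∈ d.primeFactors, (q : 𝓞 K) ∈ p := by
        rw [← hprod, Nat.cast_prod] at hdp
        exact (hp.prod_mem_iff).1 hdp
      obtain ⟨q, hq, hqp⟩ := this
      refine ⟨⟨⟨q, hq⟩, p, hp, ?_⟩, rfl⟩
      rw [Ideal.liesOver_iff]
      have hqpr := Nat.prime_of_mem_primeFactors hq
      have hpr : (Ideal.span {(q : ℤ)}).IsPrime :=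
        (Ideal.span_singleton_prime (by exact_mod_cast hqpr.ne_zero)).2 (Nat.prime_iff_prime_int.1 hqpr)
      have hmax : (Ideal.span {(q : ℤ)}).IsMaximal := hpr.isMaximal (by simpa using hqpr.ne_zero)
      refine hmax.eq_of_le (Ideal.IsPrime.ne_top (Ideal.IsPrime.under ℤ p)) ?_
      rw [Ideal.span_singleton_le_iff_mem, Ideal.under_def, Ideal.mem_comap]
      simpa using hqp
  rw [← Nat.card_congr (Equiv.ofBijective f hf)]
  have hfin : ∀ q : d.primeFactors,
      Finite (Ideal.primesOver (Ideal.span {((q : ℕ) : ℤ)}) (𝓞 K)) := fun q =>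
    Set.finite_of_ncard_ne_zero (by rw [h2 q q.2]; norm_num)
  rw [Nat.card_sigma, Finset.sum_congr rfl (fun q _ => h2 q.1 q.2)]
  simp [mul_comm]

section T
variable {K L : Type*} [Field K] [Field L] [NumberField K] [NumberField L] [Algebra K L]
  [IsGalois K L] (σ : Gal(L/K)) (hσ : ∀ g : Gal(L/K), g = 1 ∨ g = σ) (hσ1 : σ ≠ 1)
  [IsPrincipalIdealRing (𝓞 K)] (D : 𝓞 K) (S : 𝓞 L) (hS : S ^ 2 = algebraMap (𝓞 K) (𝓞 L) D)
  (hσS : σ • S = -S) (hnsq : ∀ p : Ideal (𝓞 K), p.IsPrime → D ∈ p → D ∉ p ^ 2)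

include hσ hσ1 hS hσS hnsq in
theorem card_T (hD : D ≠ 0) :
    Nat.card {v : HeightOneSpectrum (𝓞 L) | algebraMap (𝓞 K) (𝓞 L) D ∈ v.asIdeal} =
    Nat.card {p : Ideal (𝓞 K) // p.IsPrime ∧ D ∈ p} := by
  let f : {v : HeightOneSpectrum (𝓞 L) | algebraMap (𝓞 K) (𝓞 L) D ∈ v.asIdeal} →
    {p : Ideal (𝓞 K) // p.IsPrime ∧ D ∈ p} := fun v =>
      ⟨v.1.asIdeal.under (𝓞 K), have := v.1.isPrime; Ideal.IsPrime.under _ _, v.2⟩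
  refine Nat.card_congr (Equiv.ofBijective f ⟨?_, ?_⟩)
  · rintro ⟨v, hv⟩ ⟨w, hw⟩ h
    have h : v.asIdeal.under (𝓞 K) = w.asIdeal.under (𝓞 K) := congrArg Subtype.val h
    have h1 := (prime_ram σ hσ hσ1 D S hS hσS hnsq v hv).2
    have h2 := (prime_ram σ hσ hσ1 D S hS hσS hnsq w hw).2
    rw [h, h2] at h1
    have h3 : w.asIdeal ≤ v.asIdeal := by
      have := v.isPrime
      apply Ideal.IsPrime.le_of_pow_le (n := 2)
      rw [h1]; exact Ideal.pow_le_self two_ne_zero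
    have := w.isMaximal
    apply Subtype.ext
    ext1
    exact (this.eq_of_le v.isPrime.ne_top h3).symm
  · rintro ⟨p, hp, hDp⟩
    have hpbot : p ≠ ⊥ := by rintro rfl; exact hD (by simpa using hDp)
    obtain ⟨⟨P, hP, hPp⟩⟩ : Nonempty (p.primesOver (𝓞 L)) := inferInstance
    have hu := (Ideal.liesOver_iff _ _).1 hPp
    refine ⟨⟨⟨P, hP, ?_⟩, ?_⟩, ?_⟩
    · rintro rfl
      apply hpbot; rw [hu]; simp
    · rw [hu] at hDp; exact hDp
    · exact Subtype.ext hu.symm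
end T
end PartE6

section PartF1
open NumberField nonZeroDivisors IsDedekindDomain
open scoped Pointwise

theorem relIndex_mult_aux {A : Type*} [AddCommGroup A] (N F : Subgroup (Multiplicative A)) :
    N.relIndex F = (Subgroup.toAddSubgroup' N).relIndex (Subgroup.toAddSubgroup' F) := rfl

/-- The endomorphism of `Lˣ` induced by `σ`. -/
def unitSig {K L : Type*} [Field K] [Field L] [Algebra K L] (σ : Gal(L/K)) : Lˣ →* Lˣ :=
  Units.map (σ : L ≃ₐ[K] L).toAlgHom.toRingHom.toMonoidHom

theorem unitSig_coe {K L : Type*} [Field K] [Field L] [Algebra K L] (σ : Gal(L/K)) (x : Lˣ) :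
    ((unitSig σ x : Lˣ) : L) = σ (x : L) := rfl

/-- The endomorphism of the divisor group induced by `σ`. -/
noncomputable def divSig {K L : Type*} [Field K] [Field L] [NumberField L] [Algebra K L]
    (σ : Gal(L/K)) :
    Multiplicative (HeightOneSpectrum (𝓞 L) →₀ ℤ) →* Multiplicative (HeightOneSpectrum (𝓞 L) →₀ ℤ) :=
  AddMonoidHom.toMultiplicative
    (Finsupp.domCongr (M := ℤ) (primeSmul (R := 𝓞 L) σ)).toAddMonoidHom

theorem divSig_toAdd {K L : Type*} [Field K] [Field L] [NumberField L] [Algebra K L]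
    (σ : Gal(L/K)) (J : Multiplicative (HeightOneSpectrum (𝓞 L) →₀ ℤ)) :
    Multiplicative.toAdd (divSig σ J) =
      Finsupp.domCongr (M := ℤ) (primeSmul (R := 𝓞 L) σ) (Multiplicative.toAdd J) := rfl

section assembly
variable {K L : Type*} [Field K] [Field L] [NumberField K] [NumberField L] [Algebra K L]
  [IsGalois K L] (σ : Gal(L/K)) (hσ : ∀ g : Gal(L/K), g = 1 ∨ g = σ) (hσ1 : σ ≠ 1)
  [IsPrincipalIdealRing (𝓞 K)] (D : 𝓞 K) (S : 𝓞 L) (hS : S ^ 2 = algebraMap (𝓞 K) (𝓞 L) D)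
  (hσS : σ • S = -S) (hnsq : ∀ p : Ideal (𝓞 K), p.IsPrime → D ∈ p → D ∉ p ^ 2)
  (hin : ∀ P : Ideal (𝓞 L), P.IsPrime → (∀ x : 𝓞 L, σ • x - x ∈ P) →
    algebraMap (𝓞 K) (𝓞 L) D ∈ P)

omit [NumberField K] [IsGalois K L] [IsPrincipalIdealRing (𝓞 K)] in
theorem eltDiv_unitSig (x : Lˣ) : eltDiv (𝓞 L) L (unitSig σ x) = divSig σ (eltDiv (𝓞 L) L x) := by
  apply Multiplicative.toAdd.injective
  rw [divSig_toAdd]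
  exact eltDiv_smul σ x (unitSig σ x) rfl

include hσ hσ1

omit [NumberField K] [NumberField L] [IsPrincipalIdealRing (𝓞 K)] [IsGalois K L] in
theorem sig_sig (x : L) : σ (σ x) = x := by
  have := gal_two_sq σ hσ hσ1
  rw [← AlgEquiv.mul_apply, this]; rfl

omit [IsPrincipalIdealRing (𝓞 K)] in
theorem fixed_iff (x : L) : σ x = x ↔ ∃ a : K, algebraMap K L a = x := by
  constructor
  · intro h
    have : x ∈ (⊥ : IntermediateField K L) := by
      rw [IsGalois.mem_bot_iff_fixed]
      intro g
      rcases hσ g with rfl | rfl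
      · rfl
      · exact h
    exact IntermediateField.mem_bot.1 this
  · rintro ⟨a, rfl⟩; simp

omit [NumberField K] [NumberField L] [IsPrincipalIdealRing (𝓞 K)] [IsGalois K L] in
theorem primeSmul_primeSmul (v : HeightOneSpectrum (𝓞 L)) : primeSmul σ (primeSmul σ v) = v := by
  apply HeightOneSpectrum.ext
  rw [primeSmul_asIdeal, primeSmul_asIdeal, ← mul_smul, gal_two_sq σ hσ hσ1, one_smul]

omit [IsPrincipalIdealRing (𝓞 K)] in
theorem unitSig_fixed_iff (x : Lˣ) :
    unitSig σ x = x ↔ ∃ a : Kˣ, x = Units.map (algebraMap K L) a := by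
  constructor
  · intro h
    obtain ⟨a, ha⟩ := (fixed_iff σ hσ hσ1 (x : L)).1 (by rw [← unitSig_coe, h])
    have ha0 : a ≠ 0 := by rintro rfl; exact x.ne_zero (by rw [← ha, map_zero])
    exact ⟨Units.mk0 a ha0, by ext; simp [ha]⟩
  · rintro ⟨a, rfl⟩; ext; simp [unitSig_coe]

include hS hσS hnsq hin in
theorem idx_aux (Mσ : Subgroup Lˣ) (hMσ : ∀ x, x ∈ Mσ ↔ unitSig σ x = x)
    (Iσ : Subgroup (Multiplicative (HeightOneSpectrum (𝓞 L) →₀ ℤ)))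
    (hIσ : ∀ x, x ∈ Iσ ↔ divSig σ x = x)
    [Finite {v : HeightOneSpectrum (𝓞 L) | algebraMap (𝓞 K) (𝓞 L) D ∈ v.asIdeal}] :
    (∀ J, ∃ a : Lˣ, unitSig σ a = a ∧ J * divSig σ J = eltDiv (𝓞 L) L a) ∧
    (Mσ.map (eltDiv (𝓞 L) L)).relIndex Iσ =
     2 ^ Nat.card {v : HeightOneSpectrum (𝓞 L) | algebraMap (𝓞 K) (𝓞 L) D ∈ v.asIdeal} := by
  rw [relIndex_mult_aux]
  have hmem : ∀ J : HeightOneSpectrum (𝓞 L) →₀ ℤ,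
      J ∈ Subgroup.toAddSubgroup' (Mσ.map (eltDiv (𝓞 L) L)) ↔
      ∃ a : Kˣ, Multiplicative.toAdd (eltDiv (𝓞 L) L (Units.map (algebraMap K L) a)) = J := by
    intro J
    constructor
    · rintro ⟨x, hx, hxJ⟩
      obtain ⟨a, rfl⟩ := (unitSig_fixed_iff σ hσ hσ1 x).1 ((hMσ x).1 hx)
      exact ⟨a, hxJ⟩
    · rintro ⟨a, ha⟩
      exact ⟨_, (hMσ _).2 ((unitSig_fixed_iff σ hσ hσ1 _).2 ⟨a, rfl⟩), ha⟩
  have hT : ∀ v ∈ {v : HeightOneSpectrum (𝓞 L) | algebraMap (𝓞 K) (𝓞 L) D ∈ v.asIdeal},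
      primeSmul σ v = v := by
    intro v hv
    apply HeightOneSpectrum.ext
    rw [primeSmul_asIdeal]
    exact (prime_ram σ hσ hσ1 D S hS hσS hnsq v hv).1
  have hp := prime_div σ hσ hσ1 D S hS hσS hnsq hin
  have h1 : ∀ v : HeightOneSpectrum (𝓞 L), primeSmul σ v ≠ v →
      Finsupp.single v (1:ℤ) + Finsupp.single (primeSmul σ v) 1 ∈
        Subgroup.toAddSubgroup' (Mσ.map (eltDiv (𝓞 L) L)) := by
    intro v hv
    obtain ⟨a, ha, -, -⟩ := hp v
    exact (hmem _).2 ⟨a, ha hv⟩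
  have h2 : ∀ v : HeightOneSpectrum (𝓞 L), primeSmul σ v = v →
      v ∉ {v : HeightOneSpectrum (𝓞 L) | algebraMap (𝓞 K) (𝓞 L) D ∈ v.asIdeal} →
      Finsupp.single v (1:ℤ) ∈
        Subgroup.toAddSubgroup' (Mσ.map (eltDiv (𝓞 L) L)) := by
    intro v hv hv2
    obtain ⟨a, -, ha, -⟩ := hp v
    exact (hmem _).2 ⟨a, ha hv hv2⟩
  have h3 : ∀ v ∈ {v : HeightOneSpectrum (𝓞 L) | algebraMap (𝓞 K) (𝓞 L) D ∈ v.asIdeal},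
      Finsupp.single v (2:ℤ) ∈
        Subgroup.toAddSubgroup' (Mσ.map (eltDiv (𝓞 L) L)) := by
    intro v hv2
    obtain ⟨a, -, -, ha⟩ := hp v
    exact (hmem _).2 ⟨a, ha hv2⟩
  constructor
  · intro J
    obtain ⟨a, ha⟩ := (hmem _).1 (comb_norm (primeSmul σ) _ hT _ h1 h2 h3 (Multiplicative.toAdd J))
    exact ⟨_, (unitSig_fixed_iff σ hσ hσ1 _).2 ⟨a, rfl⟩, ha.symm⟩
  · refine comb_index (primeSmul σ) (primeSmul_primeSmul σ hσ hσ1) _ hT _ h1 h2 h3 _ ?_ ?_ ?_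
    · intro J; exact hIσ (Multiplicative.ofAdd J)
    · intro J hJ
      obtain ⟨a, rfl⟩ := (hmem _).1 hJ
      refine (hIσ _).2 ?_
      change divSig σ (eltDiv (𝓞 L) L (Units.map (algebraMap K L) a)) = eltDiv (𝓞 L) L (Units.map (algebraMap K L) a)
      rw [← eltDiv_unitSig, (unitSig_fixed_iff σ hσ hσ1 _).2 ⟨a, rfl⟩]
    · intro J hJ v hv
      obtain ⟨a, rfl⟩ := (hmem _).1 hJ
      exact even_div σ hσ hσ1 D S hS hσS hnsq v hv a

end assembly
end PartF1

section PartF2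
open NumberField nonZeroDivisors IsDedekindDomain
open scoped Pointwise

theorem card_two_tors_aux {L : Type*} [Field L] [CharZero L] (C : Subgroup Lˣ) (h : -1 ∈ C) :
    Nat.card {x : C // x ^ 2 = 1} = 2 := by
  rw [Nat.card_eq_two_iff]
  refine ⟨⟨1, by simp⟩, ⟨⟨-1, h⟩, by ext; simp⟩, ?_, ?_⟩
  · intro h
    have h1 : (1 : Lˣ) = -1 := congrArg (fun x => x.1.1) h
    have h2 : (1 : L) = -1 := by simpa using congrArg Units.val h1
    have : (2 : L) = 0 := by linear_combination h2
    exact two_ne_zero this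
  · ext ⟨⟨x, hxC⟩, hx⟩
    simp only [Set.mem_insert_iff, Set.mem_singleton_iff, Set.mem_univ, iff_true, Subtype.mk.injEq]
    have h1 : (x : L) ^ 2 = 1 := by
      have : x ^ 2 = 1 := congrArg Subtype.val hx
      rw [← Units.val_pow_eq_pow_val, this]; rfl
    rcases (mul_self_eq_one_iff.1 ((sq _).symm.trans h1)) with h | h
    · left; ext; simp [h]
    · right; ext; simp [h]

section assembly
variable {K L : Type*} [Field K] [Field L] [NumberField K] [NumberField L] [Algebra K L]
  [IsGalois K L] (σ : Gal(L/K)) (hσ : ∀ g : Gal(L/K), g = 1 ∨ g = σ) (hσ1 : σ ≠ 1)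
  [IsPrincipalIdealRing (𝓞 K)] (D : 𝓞 K) (S : 𝓞 L) (hS : S ^ 2 = algebraMap (𝓞 K) (𝓞 L) D)
  (hσS : σ • S = -S) (hnsq : ∀ p : Ideal (𝓞 K), p.IsPrime → D ∈ p → D ∉ p ^ 2)
  (hin : ∀ P : Ideal (𝓞 L), P.IsPrime → (∀ x : 𝓞 L, σ • x - x ∈ P) →
    algebraMap (𝓞 K) (𝓞 L) D ∈ P)

omit [NumberField K] [IsGalois K L] [IsPrincipalIdealRing (𝓞 K)] in
theorem ker_rank_aux (A : Subgroup Lˣ) (hA : A = (eltDiv (𝓞 L) L).ker) :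
    Module.Finite ℤ (Additive A) ∧
    Module.finrank ℤ (Additive A) = Module.finrank ℤ (Additive (𝓞 L)ˣ) := by
  let f : (𝓞 L)ˣ →* A := (Units.map (algebraMap (𝓞 L) L).toMonoidHom).codRestrict A (by
    intro u; rw [hA, MonoidHom.mem_ker, eltDiv_ker]; exact ⟨u, rfl⟩)
  have hf : Function.Bijective f := by
    constructor
    · intro u v h
      have : ((u : 𝓞 L) : L) = v := congrArg (fun x : A => ((x : Lˣ) : L)) h
      ext; exact this
    · rintro ⟨x, hx⟩
      have hx' := hx
      rw [hA, MonoidHom.mem_ker, eltDiv_ker] at hx'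
      obtain ⟨u, hu⟩ := hx'
      exact ⟨u, Subtype.ext (Units.ext hu)⟩
  let e : Additive (𝓞 L)ˣ ≃ₗ[ℤ] Additive A := (MulEquiv.ofBijective f hf).toAdditive.toIntLinearEquiv
  exact ⟨Module.Finite.equiv e, e.finrank_eq.symm⟩

include hσ hσ1 in
omit [IsPrincipalIdealRing (𝓞 K)] in
theorem unit_fixed_aux (x : Lˣ) (h1 : eltDiv (𝓞 L) L x = 1) (h2 : unitSig σ x = x) :
    ∃ u : (𝓞 K)ˣ, algebraMap K L ((u : 𝓞 K) : K) = x := by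
  obtain ⟨a, rfl⟩ := (unitSig_fixed_iff σ hσ hσ1 x).1 h2
  obtain ⟨u, hu⟩ := (eltDiv_ker (𝓞 L) L _).1 h1
  have hi : ∀ (b : K) (w : 𝓞 L), algebraMap K L b = w → IsIntegral ℤ b := by
    intro b w hw
    have : IsIntegral ℤ (algebraMap K L b) := by rw [hw]; exact w.isIntegral_coe
    exact (isIntegral_algebraMap_iff (algebraMap K L).injective).1 this
  have hu2 : algebraMap K L (a : K) = ((u : 𝓞 L) : L) := hu.symm
  have hu3 : algebraMap K L ((a⁻¹ : Kˣ) : K) = (((u⁻¹ : (𝓞 L)ˣ) : 𝓞 L) : L) := by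
    have h5 : ((u : 𝓞 L) : L) * (((u⁻¹ : (𝓞 L)ˣ) : 𝓞 L) : L) = 1 := by
      have := congrArg (algebraMap (𝓞 L) L) u.mul_inv
      rwa [map_mul, map_one] at this
    rw [Units.val_inv_eq_inv_val, map_inv₀, hu2]
    exact inv_eq_of_mul_eq_one_right h5
  exact ⟨⟨⟨a, hi _ _ hu2⟩, ⟨(a⁻¹ : Kˣ), hi _ _ hu3⟩, RingOfIntegers.ext a.mul_inv,
    RingOfIntegers.ext a.inv_mul⟩, rfl⟩

include hσ hσ1 in
omit [IsPrincipalIdealRing (𝓞 K)] in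
theorem fixed_rank_aux (C : Subgroup Lˣ)
    (hC : ∀ x, x ∈ C ↔ x ∈ (eltDiv (𝓞 L) L).ker ∧ unitSig σ x = x) :
    Module.finrank ℤ (Additive C) = Module.finrank ℤ (Additive (𝓞 K)ˣ) := by
  let f : (𝓞 K)ˣ →* C :=
    ((Units.map (algebraMap K L).toMonoidHom).comp (Units.map (algebraMap (𝓞 K) K).toMonoidHom)).codRestrict C (by
    intro u; rw [hC, MonoidHom.mem_ker, eltDiv_ker]
    exact ⟨⟨Units.map (algebraMap (𝓞 K) (𝓞 L)) u, rfl⟩, (unitSig_fixed_iff σ hσ hσ1 _).2 ⟨_, rfl⟩⟩)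
  have hf : Function.Bijective f := by
    constructor
    · intro u v h
      have : algebraMap K L ((u : 𝓞 K) : K) = algebraMap K L ((v : 𝓞 K) : K) :=
        congrArg (fun x : C => ((x : Lˣ) : L)) h
      ext; exact (algebraMap K L).injective this
    · rintro ⟨x, hx⟩
      obtain ⟨u, hu⟩ := unit_fixed_aux σ hσ hσ1 x ((hC x).1 hx).1 ((hC x).1 hx).2
      exact ⟨u, Subtype.ext (Units.ext hu)⟩
  let e : Additive (𝓞 K)ˣ ≃ₗ[ℤ] Additive C := (MulEquiv.ofBijective f hf).toAdditive.toIntLinearEquiv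
  exact e.finrank_eq.symm

include hσ hσ1 hS hσS hnsq hin in
theorem count_aux (hunit : ∀ u : (𝓞 K)ˣ, IsNm (D : K) ((u : 𝓞 K) : K))
    (hrK : Module.finrank ℤ (Additive (𝓞 K)ˣ) = 1) (hrL : Module.finrank ℤ (Additive (𝓞 L)ˣ) = 3)
    [Finite {v : HeightOneSpectrum (𝓞 L) | algebraMap (𝓞 K) (𝓞 L) D ∈ v.asIdeal}] :
    Nat.card {c : ClassGroup (𝓞 L) // c ^ 2 = 1} * 2 =
     2 ^ Nat.card {v : HeightOneSpectrum (𝓞 L) | algebraMap (𝓞 K) (𝓞 L) D ∈ v.asIdeal} := by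
  have hss : ∀ x, unitSig σ (unitSig σ x) = x := fun x => Units.ext (sig_sig σ hσ hσ1 x)
  have hσs : σ (S : L) = - (S : L) := by
    have := congrArg (algebraMap (𝓞 L) L) hσS
    rw [map_neg] at this
    exact this
  have hS2 : (S : L) ^ 2 = algebraMap K L (D : K) := by
    have := congrArg (algebraMap (𝓞 L) L) hS
    rw [map_pow] at this
    exact this
  have hS0 : (S : L) ≠ 0 := by
    intro h
    have h0 : S = 0 := RingOfIntegers.ext (by simpa using h)
    have hD0 : D = 0 := by
      apply FaithfulSMul.algebraMap_injective (𝓞 K) (𝓞 L); rw [← hS, h0]; simp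
    refine hnsq ⊥ Ideal.isPrime_bot (by simp [hD0]) (by simp [hD0])
  let C : Subgroup Lˣ := (eltDiv (𝓞 L) L).ker ⊓ (unitSig σ).eqLocus (MonoidHom.id _)
  let B : Subgroup Lˣ := (eltDiv (𝓞 L) L).ker ⊓ (MonoidHom.id _ * unitSig σ).ker
  let NA : Subgroup Lˣ := (eltDiv (𝓞 L) L).ker.map (MonoidHom.id _ * unitSig σ)
  let E : Subgroup Lˣ := (eltDiv (𝓞 L) L).ker.map (MonoidHom.id _ / unitSig σ)
  have hC : ∀ x, x ∈ C ↔ x ∈ (eltDiv (𝓞 L) L).ker ∧ unitSig σ x = x := fun x => Iff.rfl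
  have hB : ∀ x, x ∈ B ↔ x ∈ (eltDiv (𝓞 L) L).ker ∧ x * unitSig σ x = 1 := fun x => Iff.rfl
  have hN : ∀ x, x ∈ NA ↔ ∃ y ∈ (eltDiv (𝓞 L) L).ker, y * unitSig σ y = x := fun x => Iff.rfl
  have hE : ∀ x, x ∈ E ↔ ∃ y ∈ (eltDiv (𝓞 L) L).ker, y / unitSig σ y = x := fun x => Iff.rfl
  have hA : ∀ x ∈ (eltDiv (𝓞 L) L).ker, unitSig σ x ∈ (eltDiv (𝓞 L) L).ker := by
    intro x hx
    rw [MonoidHom.mem_ker] at hx ⊢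
    rw [eltDiv_unitSig, hx, map_one]
  have hneg : (-1 : Lˣ) ∈ (eltDiv (𝓞 L) L).ker := by
    rw [MonoidHom.mem_ker, eltDiv_ker]; exact ⟨-1, by simp⟩
  have hneg2 : unitSig σ (-1) = -1 := by ext; simp [unitSig_coe]
  have hnC : -1 ∈ C := (hC _).2 ⟨hneg, hneg2⟩
  have hnB : -1 ∈ B := (hB _).2 ⟨hneg, by rw [hneg2]; simp⟩
  obtain ⟨fA, rA⟩ := ker_rank_aux (eltDiv (𝓞 L) L).ker rfl
  obtain ⟨fC, fB, hr⟩ := finrank_norm_one_aux (unitSig σ) hss (eltDiv (𝓞 L) L).ker hA C B hC hB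
  have rC : Module.finrank ℤ (Additive C) = 1 := (fixed_rank_aux σ hσ hσ1 C hC).trans hrK
  have rB : Module.finrank ℤ (Additive B) = 2 := by rw [rC, rA, hrL] at hr; omega
  have hc := sq_relIndex_aux C (card_two_tors_aux C hnC)
  have hb := sq_relIndex_aux B (card_two_tors_aux B hnB)
  rw [rC] at hc
  rw [rB] at hb
  obtain ⟨e, f, he, hf, hef⟩ := herbrand_aux (unitSig σ) hss _ hA C B NA E hC hB hN hE _ _ hc hb
  let Mσ : Subgroup Lˣ := (unitSig σ).eqLocus (MonoidHom.id _)
  let Iσ := (divSig (K := K) (L := L) σ).eqLocus (MonoidHom.id _)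
  obtain ⟨hnorm, ht⟩ := idx_aux σ hσ hσ1 D S hS hσS hnsq hin Mσ (fun x => Iff.rfl) Iσ (fun x => Iff.rfl)
  have hττ : ∀ x, divSig (K := K) (L := L) σ (divSig σ x) = x := by
    intro x
    apply Multiplicative.toAdd.injective
    rw [divSig_toAdd, divSig_toAdd]
    ext v
    simp only [Finsupp.domCongr_apply, Finsupp.equivMapDomain_apply]
    congr 1
    rw [Equiv.symm_apply_eq, Equiv.symm_apply_eq, primeSmul_primeSmul σ hσ hσ1]
  have key := ambiguous_aux (unitSig σ) (divSig σ) hss hττ (eltDiv (𝓞 L) L) (eltDiv_unitSig σ)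
    (by
      intro x hx
      have hx : (x : L) * σ (x : L) = 1 := congrArg Units.val hx
      by_cases h : (1 : L) + x = 0
      · refine ⟨Units.mk0 (S : L) hS0, ?_⟩
        ext
        rw [Units.val_div_eq_div_val, unitSig_coe]
        simp only [Units.val_mk0, hσs]
        rw [div_neg, div_self hS0]
        linear_combination h
      · refine ⟨Units.mk0 _ h, ?_⟩
        ext
        rw [Units.val_div_eq_div_val, unitSig_coe]
        simp only [Units.val_mk0, map_add, map_one]
        have h2 : (1 : L) + σ x ≠ 0 := by
          intro h3
          apply h
          have := congrArg σ h3
          simpa [sig_sig σ hσ hσ1] using this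
        rw [eq_div_iff h2]
        linear_combination hx)
    (by
      intro x hx
      obtain ⟨y, hy⟩ := comb_h90 (primeSmul σ) (primeSmul_primeSmul σ hσ hσ1) (Multiplicative.toAdd x)
        (congrArg Multiplicative.toAdd hx)
      exact ⟨Multiplicative.ofAdd y, hy⟩)
    hnorm
    (by
      intro u hu1 hu2
      obtain ⟨w, hw⟩ := unit_fixed_aux σ hσ hσ1 u hu1 hu2
      obtain ⟨X, Y, hXY⟩ := hunit w
      have h4 : (algebraMap K L X + algebraMap K L Y * S) * (algebraMap K L X - algebraMap K L Y * S) = u := by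
        rw [← hw, ← hXY, map_sub, map_mul, map_pow, map_pow, ← hS2]; ring
      have h5 : algebraMap K L X + algebraMap K L Y * S ≠ 0 := by
        intro h; rw [h, zero_mul] at h4; exact u.ne_zero h4.symm
      refine ⟨Units.mk0 _ h5, ?_⟩
      ext
      rw [Units.val_mul, unitSig_coe, ← h4]
      simp [hσs, sub_eq_add_neg])
    C B NA E hC hB hN hE e f _ he hf Mσ (fun x => Iff.rfl) Iσ (fun x => Iff.rfl) ht
  rw [card_classGroup_two (𝓞 L) L]
  have : f = e + 1 := by omega
  rw [this, pow_add, pow_add, mul_comm (2 ^ e), ← mul_assoc] at key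
  exact Nat.eq_of_mul_eq_mul_right (by positivity) key

end assembly
end PartF2

section PartF3
open NumberField nonZeroDivisors IsDedekindDomain
open scoped Pointwise

theorem d_mod_four (d : ℕ) (hd : Squarefree d) (hp : ∀ p ∈ d.primeFactors, p % 8 = 7) :
    d % 4 = 1 ∨ d % 4 = 3 := by
  have h2 : ¬ 2 ∣ d := by
    intro h
    have := hp 2 (Nat.mem_primeFactors.2 ⟨Nat.prime_two, h, hd.ne_zero⟩)
    omega
  omega

/-- The key integrality fact: only primes dividing `d` ramify. -/
theorem hin_aux {K L : Type*} [Field K] [Field L] [NumberField L] [Algebra K L]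
    (σ : Gal(L/K)) (d : ℕ) (hd4 : d % 4 = 1 ∨ d % 4 = 3) (i : K) (hi : i ^ 2 = -1)
    (s : L) (hs : s ^ 2 = (d : L)) (hσs : σ s = -s)
    (P : Ideal (𝓞 L)) (hPp : P.IsPrime) (hP : ∀ x : 𝓞 L, σ • x - x ∈ P) : (d : 𝓞 L) ∈ P := by
  obtain ⟨t, ht1, ht2, ht3⟩ : ∃ t : L, σ t = -t ∧ t ^ 4 = (d : L) ^ 2 ∧
      ∃ m : ℤ, t ^ 2 = 4 * (m : L) + 1 := by
    rcases hd4 with h | h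
    · obtain ⟨m, hm⟩ : ∃ m : ℕ, d = 4 * m + 1 := ⟨d / 4, by omega⟩
      refine ⟨s, hσs, by linear_combination (s ^ 2 + d) * hs, m, ?_⟩
      rw [hs, hm]; push_cast; ring
    · have hi' : (algebraMap K L i) ^ 2 = -1 := by rw [← map_pow, hi]; simp
      obtain ⟨m, hm⟩ : ∃ m : ℕ, d = 4 * m + 3 := ⟨d / 4, by omega⟩
      refine ⟨algebraMap K L i * s, by simp [hσs], ?_, -(m + 1), ?_⟩
      · rw [mul_pow]
        linear_combination (s ^ 4) * ((algebraMap K L i) ^ 2 - 1) * hi' + (s ^ 2 + d) * hs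
      · rw [mul_pow, hs, hi', hm]; push_cast; ring
  obtain ⟨m, hm⟩ := ht3
  have h_integral : IsIntegral ℤ ((1 + t) / 2) := by
    refine ⟨Polynomial.X ^ 2 - Polynomial.X - Polynomial.C m, by monicity!, ?_⟩
    rw [Polynomial.eval₂_sub, Polynomial.eval₂_sub, Polynomial.eval₂_pow, Polynomial.eval₂_X,
      Polynomial.eval₂_C, eq_intCast]
    linear_combination hm / 4
  obtain ⟨θ, hθ⟩ : ∃ θ : 𝓞 L, (θ : L) = (1 + t) / 2 := ⟨⟨_, h_integral⟩, rfl⟩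
  have h1 := hP θ
  have h2 : (d : 𝓞 L) ^ 2 = (σ • θ - θ) ^ 4 := by
    apply RingOfIntegers.ext
    have e1 : ((σ • θ : 𝓞 L) : L) = σ (θ : L) := rfl
    have e2 : ((((σ • θ - θ) ^ 4 : 𝓞 L)) : L) = (σ (θ : L) - θ) ^ 4 := by
      rw [← e1]; push_cast; rfl
    have e3 : ((((d : 𝓞 L)) ^ 2 : 𝓞 L) : L) = (d : L) ^ 2 := by push_cast; rfl
    rw [e2, e3, hθ]
    simp only [map_div₀, map_add, map_one, map_ofNat, ht1]
    rw [← ht2]; ring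
  exact hPp.mem_of_pow_mem 2 (h2 ▸ P.pow_mem_of_mem h1 4 (by norm_num))

theorem main_aux (K L : Type*) [Field K] [Field L] [NumberField K] [NumberField L] [Algebra K L]
    [hK : IsCyclotomicExtension {8} ℚ K] (h2 : Module.finrank K L = 2)
    (d : ℕ) (hd2 : 2 < d) (hd : Squarefree d) (hp : ∀ p ∈ d.primeFactors, p % 8 = 7)
    (s : L) (hs : s ^ 2 = (d : L)) :
    Nat.card {c : ClassGroup (𝓞 L) // c ^ 2 = 1} * 2 = 2 ^ (2 * d.primeFactors.card) := by
  have : Algebra.IsQuadraticExtension K L := { finrank_eq_two' := h2 }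
  have hcardG : Nat.card Gal(L/K) = 2 := (IsGalois.card_aut_eq_finrank K L).trans h2
  obtain ⟨σ, hσ1, hσ⟩ : ∃ σ : Gal(L/K), σ ≠ 1 ∧ ∀ g : Gal(L/K), g = 1 ∨ g = σ := by
    obtain ⟨σ, h1, h2⟩ := (Nat.card_eq_two_iff' (1 : Gal(L/K))).1 hcardG
    exact ⟨σ, h1, fun g => or_iff_not_imp_left.2 (h2 g)⟩
  have := cyc8_pid K
  have hσs : σ s = -s := by
    have : (σ s) ^ 2 = s ^ 2 := by rw [← map_pow, hs]; simp
    rcases sq_eq_sq_iff_eq_or_eq_neg.1 this with h | h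
    · exfalso
      obtain ⟨a, ha⟩ := (fixed_iff σ hσ hσ1 s).1 h
      apply cyc8_d_notSquare K d hd2 hd hp
      refine ⟨a, (algebraMap K L).injective ?_⟩
      rw [map_mul, ha, ← sq, hs, map_natCast]
    · exact h
  have hsint : IsIntegral ℤ s := by
    refine IsIntegral.of_pow (n := 2) (by norm_num) ?_
    rw [hs]; simpa using isIntegral_algebraMap (R := ℤ) (A := L) (x := (d : ℤ))
  obtain ⟨S, hSs⟩ : ∃ S : 𝓞 L, (S : L) = s := ⟨⟨s, hsint⟩, rfl⟩
  have hS : S ^ 2 = algebraMap (𝓞 K) (𝓞 L) (d : 𝓞 K) := by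
    apply RingOfIntegers.ext; simp [hSs, hs]
  have hσS : σ • S = -S := by
    apply RingOfIntegers.ext
    have e1 : ((σ • S : 𝓞 L) : L) = σ (S : L) := rfl
    rw [e1, hSs, hσs, ← hSs]; push_cast; rfl
  have hnsq : ∀ p : Ideal (𝓞 K), p.IsPrime → (d : 𝓞 K) ∈ p → (d : 𝓞 K) ∉ p ^ 2 :=
    fun p hpp hm => cyc8_d_notMem_sq K d hd hp p hm
  have hζ := IsCyclotomicExtension.zeta_spec 8 ℚ K
  have h4 : (IsCyclotomicExtension.zeta 8 ℚ K ^ 2) ^ 2 = -1 := by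
    have h := (hζ.pow (by norm_num) (show 8 = 4 * 2 by norm_num)).eq_neg_one_of_two_right
    rw [← pow_mul]; exact h
  have hin : ∀ P : Ideal (𝓞 L), P.IsPrime → (∀ x : 𝓞 L, σ • x - x ∈ P) →
      algebraMap (𝓞 K) (𝓞 L) (d : 𝓞 K) ∈ P := by
    intro P hP h
    rw [map_natCast]
    exact hin_aux σ d (d_mod_four d hd hp) _ h4 s hs hσs P hP h
  have hd0 : (d : 𝓞 K) ≠ 0 := by exact_mod_cast hd.ne_zero
  have hT := card_T σ hσ hσ1 (d : 𝓞 K) S hS hσS hnsq hd0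
  rw [card_TK K d hd (fun q hq => cyc8_ncard K q (Nat.prime_of_mem_primeFactors hq) (hp q hq))] at hT
  have hr : d.primeFactors.card ≠ 0 := by
    rw [Finset.card_ne_zero, Nat.nonempty_primeFactors]; omega
  have hfin : Finite {v : HeightOneSpectrum (𝓞 L) | algebraMap (𝓞 K) (𝓞 L) (d : 𝓞 K) ∈ v.asIdeal} :=
    Nat.finite_of_card_ne_zero (by rw [hT]; omega)
  have hrL : Module.finrank ℤ (Additive (𝓞 L)ˣ) = 3 := by
    have hc : IsTotallyComplex K := IsCyclotomicExtension.Rat.isTotallyComplex K (n := 8) (by norm_num)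
    have hc : IsTotallyComplex L := isTotallyComplex_of_algebra K L
    rw [NumberField.Units.finrank_eq, Units.rank]
    have e1 := IsTotallyComplex.finrank L
    have e2 := IsTotallyComplex.nrRealPlaces_eq_zero L
    rw [← Module.finrank_mul_finrank ℚ K L, cyc8_finrank K, h2] at e1
    rw [InfinitePlace.card_eq_nrRealPlaces_add_nrComplexPlaces]
    omega
  rw [← hT]
  refine count_aux σ hσ hσ1 (d : 𝓞 K) S hS hσS hnsq hin ?_ (cyc8_rank K) hrL
  intro u
  have e1 : ((d : 𝓞 K) : K) = (d : K) := by push_cast; rfl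
  rw [e1]
  exact cyc8_unit_isNm K d hd2 hd hp u

theorem final_aux (d : ℕ) (hd2 : 2 < d) (hd : Squarefree d)
    (r : ℕ) (hcard : d.primeFactors.card = r)
    (hprimes : ∀ p ∈ d.primeFactors, p % 8 = 7)
    (L : Type) [Field L] [NumberField L]
    (ζ : L) (hζ : IsPrimitiveRoot ζ 8) (s : L) (hs : s ^ 2 = (d : L))
    (hgen : Algebra.adjoin ℚ {ζ, s} = ⊤) :
    Nat.card {c : ClassGroup (𝓞 L) // c ^ 2 = 1} = 2 ^ (2 * r - 1) := by
  let K := IntermediateField.adjoin ℚ {ζ}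
  have hK : IsCyclotomicExtension {8} ℚ K := hζ.intermediateField_adjoin_isCyclotomicExtension ℚ
  have h_integral : IsIntegral K s := Algebra.IsIntegral.isIntegral s
  have htop : IntermediateField.adjoin K {s} = ⊤ := by
    rw [eq_top_iff]
    intro x _
    have hx : x ∈ Algebra.adjoin ℚ {ζ, s} := by rw [hgen]; trivial
    induction hx using Algebra.adjoin_induction with
    | mem x hx =>
      rcases hx with rfl | rfl
      · exact (IntermediateField.adjoin K {s}).algebraMap_mem
          ⟨x, IntermediateField.mem_adjoin_simple_self ℚ x⟩
      · exact IntermediateField.mem_adjoin_simple_self K x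
    | algebraMap q => exact (IntermediateField.adjoin K {s}).algebraMap_mem (algebraMap ℚ K q)
    | add x y _ _ hx hy => exact add_mem (hx trivial) (hy trivial)
    | mul x y _ _ hx hy => exact mul_mem (hx trivial) (hy trivial)
  have h2 : Module.finrank K L = 2 := by
    have h1 := IntermediateField.adjoin.finrank h_integral
    rw [htop, IntermediateField.finrank_top'] at h1
    have hle : (minpoly K s).natDegree ≤ 2 := by
      have hne : (Polynomial.X ^ 2 - Polynomial.C (d : K)) ≠ 0 :=
        Polynomial.X_pow_sub_C_ne_zero (by norm_num) _
      have := Polynomial.natDegree_le_of_dvd (minpoly.dvd K s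
        (p := Polynomial.X ^ 2 - Polynomial.C (d : K)) (by simp [hs])) hne
      rwa [Polynomial.natDegree_X_pow_sub_C] at this
    have hpos : 0 < (minpoly K s).natDegree := minpoly.natDegree_pos h_integral
    have hne1 : (minpoly K s).natDegree ≠ 1 := by
      intro h
      obtain ⟨a, ha⟩ := minpoly.natDegree_eq_one_iff.1 h
      apply cyc8_d_notSquare K d hd2 hd hprimes
      refine ⟨a, (algebraMap K L).injective ?_⟩
      rw [map_mul, ha, ← sq, hs, map_natCast]
    omega
  have h := main_aux K L h2 d hd2 hd hprimes s hs
  rw [hcard] at h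
  have hr : r ≠ 0 := by
    rw [← hcard, Finset.card_ne_zero, Nat.nonempty_primeFactors]; omega
  obtain ⟨k, hk⟩ : ∃ k, 2 * r = k + 1 := ⟨2 * r - 1, by omega⟩
  rw [hk, pow_succ] at h
  rw [hk, Nat.add_sub_cancel]
  exact Nat.eq_of_mul_eq_mul_right (by norm_num) h
end PartF3

open NumberField

/-- Let `d > 2` be a squarefree product of `r` distinct primes all congruent to
`7 (mod 8)`. Then the rank of the 2-class group of `L_d = ℚ(ζ₈, √d)` equals `2r - 1`,
i.e. the 2-torsion subgroup of the class group has order `2 ^ (2r - 1)`. -/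
theorem stmt_17 (d : ℕ) (hd2 : 2 < d) (hd : Squarefree d)
    (r : ℕ) (hcard : d.primeFactors.card = r)
    (hprimes : ∀ p ∈ d.primeFactors, p % 8 = 7)
    (L : Type) [Field L] [NumberField L]
    (ζ : L) (hζ : IsPrimitiveRoot ζ 8) (s : L) (hs : s ^ 2 = (d : L))
    (hgen : Algebra.adjoin ℚ {ζ, s} = ⊤) :
    Nat.card {c : ClassGroup (𝓞 L) // c ^ 2 = 1} = 2 ^ (2 * r - 1) := by
  exact final_aux d hd2 hd r hcard hprimes L ζ hζ s hs hgen
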